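/- arXiv:0909.0670 — 5 statements merged into one kernel-verified Lean document; each statement's English description precedes it below -/
import Mathlib

section
/- Let a be a positive integer and p a prime with p \ge a+2. If a is odd, then H(-a;p-1) \equiv -\frac{2(1-2^{p-a})}{a} B_{p-a} \pmod{p}. If a is even, then H(-a;p-1) \equiv \frac{a(1-2^{p-1-a})}{a+1} p\, B_{p-1-a} \pmod{p^2}. -/
open Finset

/-- sign of an integer as a rational: `-1` if negative, else `1`. -/
def sgn (s : ℤ) : ℚ := if s < 0 then -1 else 1

/-- Auxiliary: alternating multiple harmonic sum with the index list reversed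
    (head of the list corresponds to the outermost, i.e. largest, summation index). -/
def Hrev : List ℤ → ℕ → ℚ
  | [], _ => 1
  | s :: t, n => ∑ k ∈ Finset.Icc 1 n, (sgn s) ^ k / (k : ℚ) ^ s.natAbs * Hrev t (k - 1)

/-- The alternating multiple harmonic sum `H(s₁,…,s_d; n)`:
    the sum over `1 ≤ k₁ < ⋯ < k_d ≤ n` of `∏ sign(sᵢ)^{kᵢ}/kᵢ^{|sᵢ|}`. -/
def H (s : List ℤ) (n : ℕ) : ℚ := Hrev s.reverse n

/-- Auxiliary for the non-strict version. -/
def Srev : List ℤ → ℕ → ℚ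
  | [], _ => 1
  | s :: t, n => ∑ k ∈ Finset.Icc 1 n, (sgn s) ^ k / (k : ℚ) ^ s.natAbs * Srev t k

/-- The non-strict alternating multiple harmonic sum `S(s₁,…,s_d; n)`:
    the sum over `1 ≤ k₁ ≤ ⋯ ≤ k_d ≤ n`. -/
def S (s : List ℤ) (n : ℕ) : ℚ := Srev s.reverse n

/-- `x ≡ y (mod m)` for rationals: the numerator of `x - y` in lowest terms is
    divisible by `m`. -/
def pcong (m : ℕ) (x y : ℚ) : Prop := (m : ℤ) ∣ (x - y).num

/-- The Fermat quotient of 2 : `q_p = (2^{p-1}-1)/p`. -/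
def qp (p : ℕ) : ℚ := (2 ^ (p - 1) - 1) / p

/-- `s ⊕ t = sign(st)(|s|+|t|)`, with the convention that `0 ⊕ t = t` and `s ⊕ 0 = s`. -/
def oplus (s t : ℤ) : ℤ :=
  if s = 0 then t else if t = 0 then s else (s * t).sign * (|s| + |t|)

theorem H_singleton_neg (a : ℕ) (ha : 0 < a) (n : ℕ) :
    H [-(a : ℤ)] n = ∑ k ∈ Icc 1 n, (-1) ^ k / (k : ℚ) ^ a := by
  have h : sgn (-(a : ℤ)) = -1 := if_pos (by omega)
  simp [H, Hrev, h]

theorem not_dvd_of_mem_Icc {p k : ℕ} (hk : k ∈ Icc 1 (p - 1)) : ¬ p ∣ k := by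
  rw [mem_Icc] at hk
  exact Nat.not_dvd_of_pos_of_lt (by omega) (by omega)

/-- The subring of `ℚ` of fractions whose denominator is prime to `p`. -/
abbrev pIntegers (p : ℕ) [Fact p.Prime] : Subring ℚ := (Rat.padicValuation p).integer

section

variable {p : ℕ} [Fact p.Prime]

theorem mem_pIntegers_iff {x : ℚ} : x ∈ pIntegers p ↔ ¬ p ∣ x.den :=
  Rat.padicValuation_le_one_iff

theorem inv_natCast_mem_pIntegers {c : ℕ} (hc : ¬ p ∣ c) : (c : ℚ)⁻¹ ∈ pIntegers p := by
  rw [mem_pIntegers_iff]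
  have hc0 : c ≠ 0 := by rintro rfl; simp at hc
  rwa [Rat.inv_natCast_den_of_pos (Nat.pos_of_ne_zero hc0)]

theorem inv_two_mem_pIntegers (h2 : p ≠ 2) : (2 : ℚ)⁻¹ ∈ pIntegers p :=
  mod_cast inv_natCast_mem_pIntegers (p := p) (c := 2) fun h ↦
    h2 ((Nat.prime_dvd_prime_iff_eq Fact.out Nat.prime_two).1 h)

theorem pcong_of_eq_add {r : ℕ} {x y z : ℚ} (hz : z ∈ pIntegers p)
    (h : x = y + (p : ℚ) ^ r * z) : pcong (p ^ r) x y := by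
  have hxy : x - y = (p : ℚ) ^ r * z := by rw [h]; ring
  rw [mem_pIntegers_iff] at hz
  have hcop : IsCoprime ((p ^ r : ℕ) : ℤ) (z.den : ℤ) :=
    Nat.isCoprime_iff_coprime.2
      (((Nat.Prime.coprime_iff_not_dvd Fact.out).2 hz).pow_left r)
  refine hcop.dvd_of_dvd_mul_right ⟨z.num * (x - y).den, ?_⟩
  have h1 := Rat.num_div_den (x - y)
  have h2 := Rat.num_div_den z
  have d1 : ((x - y).den : ℚ) ≠ 0 := by simp
  have d2 : (z.den : ℚ) ≠ 0 := by simp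
  have h3 : ((x - y).num : ℚ) * z.den = (p : ℚ) ^ r * (z.num * (x - y).den) := by
    rw [div_eq_iff d1] at h1
    rw [div_eq_iff d2] at h2
    rw [h1, h2]
    linear_combination (z.den * (x - y).den : ℚ) * hxy
  exact_mod_cast h3

theorem bernoulli'_mem_pIntegers {n : ℕ} (hn : n + 1 < p) : bernoulli' n ∈ pIntegers p := by
  induction n using Nat.strong_induction_on with
  | _ n ih =>
    rw [bernoulli'_def]
    refine sub_mem (one_mem _) (sum_mem fun k hk ↦ ?_)
    have hk := mem_range.1 hk
    refine mul_mem ?_ (ih k hk (by omega))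
    rw [div_eq_mul_inv]
    refine mul_mem (natCast_mem _ _) ?_
    have h : (n : ℚ) - k + 1 = ((n - k + 1 : ℕ) : ℚ) := by
      push_cast [Nat.cast_sub hk.le]; ring
    rw [h]
    exact inv_natCast_mem_pIntegers (Nat.not_dvd_of_pos_of_lt (by omega) (by omega))

theorem bernoulli_mem_pIntegers {n : ℕ} (hn : n + 1 < p) : bernoulli n ∈ pIntegers p :=
  mul_mem (pow_mem (neg_mem (one_mem _)) _) (bernoulli'_mem_pIntegers hn)

/-- Up to `p - 1`, a Bernoulli polynomial has `p`-integral coefficients apart possibly from the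
constant one, so its values at congruent arguments are congruent. -/
theorem bernoulli_eval_congr {n : ℕ} (hn : n < p) {x y z : ℚ} (hx : x ∈ pIntegers p)
    (hy : y ∈ pIntegers p) (hz : z ∈ pIntegers p) (h : x = y + p * z) :
    ∃ w ∈ pIntegers p, (Polynomial.bernoulli n).eval x =
      (Polynomial.bernoulli n).eval y + p * w := by
  have key : ∀ i ∈ range (n + 1), ∃ w ∈ pIntegers p,
      bernoulli i * n.choose i * x ^ (n - i) =
        bernoulli i * n.choose i * y ^ (n - i) + p * w := by
    intro i hi
    rcases Nat.eq_zero_or_pos (n - i) with hi0 | hi0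
    · exact ⟨0, zero_mem _, by simp [hi0]⟩
    · obtain ⟨⟨c, hc⟩, hce⟩ := sub_dvd_pow_sub_pow (⟨x, hx⟩ : pIntegers p) ⟨y, hy⟩ (n - i)
      have hce' : x ^ (n - i) - y ^ (n - i) = (x - y) * c := congrArg Subtype.val hce
      refine ⟨bernoulli i * n.choose i * (z * c), ?_, ?_⟩
      · exact mul_mem (mul_mem (bernoulli_mem_pIntegers (by omega)) (natCast_mem _ _))
          (mul_mem hz hc)
      · rw [h, add_sub_cancel_left] at hce'
        rw [h]
        linear_combination (bernoulli i * n.choose i) * hce'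
  choose! w hw hwe using key
  refine ⟨∑ i ∈ range (n + 1), w i, sum_mem hw, ?_⟩
  simp only [Polynomial.bernoulli, Polynomial.eval_finsetSum, Polynomial.eval_monomial]
  rw [sum_congr rfl hwe, sum_add_distrib, mul_sum]

end

theorem bernoulli_eval_one_half (n : ℕ) :
    2 ^ n * (Polynomial.bernoulli n).eval (1 / 2) = (2 - 2 ^ n) * bernoulli n := by
  open PowerSeries in
  set F : ℚ⟦X⟧ := bernoulliPowerSeries ℚ with hF
  set G : ℚ⟦X⟧ := PowerSeries.mk fun n ↦
    Polynomial.aeval (1 / 2 : ℚ) ((1 / n.factorial : ℚ) • Polynomial.bernoulli n) with hG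
  set E : ℚ⟦X⟧ := rescale (1 / 2 : ℚ) (exp ℚ) with hE
  have h1 : F * (exp ℚ - 1) = X := bernoulliPowerSeries_mul_exp_sub_one ℚ
  have h2 : G * (exp ℚ - 1) = X * E := Polynomial.bernoulli_generating_function (1 / 2 : ℚ)
  have h3 : E * E = exp ℚ := by
    have := exp_mul_exp_eq_exp_add (1 / 2 : ℚ) (1 / 2)
    norm_num at this
    simpa [hE] using this
  have h4 : rescale (1 / 2 : ℚ) F * (E - 1) = C (1 / 2 : ℚ) * X := by
    have := congrArg (rescale (1 / 2 : ℚ)) h1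
    simpa [rescale_X, hE] using this
  have hne : exp ℚ - 1 ≠ 0 := by
    intro h; rw [h, mul_zero] at h1; exact X_ne_zero h1.symm
  have h5 : G + F = C (2 : ℚ) * rescale (1 / 2 : ℚ) F := by
    apply mul_right_cancel₀ hne
    have hC : (C (2 : ℚ) : ℚ⟦X⟧) * C (1 / 2 : ℚ) = 1 := by rw [← map_mul]; norm_num
    have h6 : exp ℚ - 1 = (E - 1) * (E + 1) := by rw [← h3]; ring
    calc (G + F) * (exp ℚ - 1) = X * (E + 1) := by linear_combination h1 + h2
      _ = C (2 : ℚ) * rescale (1 / 2 : ℚ) F * (exp ℚ - 1) := by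
        rw [h6]
        linear_combination (-C (2 : ℚ) * (E + 1)) * h4 - (X * (E + 1)) * hC
  have h7 := congrArg (coeff n) h5
  simp [hG, hF, bernoulliPowerSeries, coeff_rescale] at h7
  have hf : (n.factorial : ℚ) ≠ 0 := by exact_mod_cast n.factorial_ne_zero
  field_simp at h7
  linear_combination h7

theorem sum_range_alternating_pow (h m : ℕ) :
    ∑ k ∈ range (2 * h + 1), (-1) ^ k * (k : ℚ) ^ m =
      2 ^ (m + 1) * ∑ j ∈ range (h + 1), (j : ℚ) ^ m - ∑ k ∈ range (2 * h + 1), (k : ℚ) ^ m := by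
  induction h with
  | zero =>
    rcases m.eq_zero_or_pos with rfl | hm
    · norm_num
    · simp [hm.ne']
  | succ h ih =>
    rw [show 2 * (h + 1) + 1 = 2 * h + 1 + 1 + 1 by ring, sum_range_succ, sum_range_succ, ih,
      sum_range_succ _ (h + 1), sum_range_succ _ (2 * h + 1 + 1), sum_range_succ _ (2 * h + 1)]
    have e1 : (-1 : ℚ) ^ (2 * h + 1) = -1 := (odd_two_mul_add_one h).neg_one_pow
    have e2 : (-1 : ℚ) ^ (2 * h + 1 + 1) = 1 := (odd_two_mul_add_one h).add_one.neg_one_pow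
    have e3 : ((2 * h + 1 + 1 : ℕ) : ℚ) ^ m = 2 ^ m * ((h + 1 : ℕ) : ℚ) ^ m := by
      rw [← mul_pow]; push_cast; ring
    rw [e1, e2, e3]
    ring

section

variable {p : ℕ} [Fact p.Prime]

theorem alternating_power_sum_congr (h2 : p ≠ 2) {m : ℕ} (hm : m + 1 < p) :
    ∃ z ∈ pIntegers p, (m + 1) * ∑ k ∈ range p, (-1) ^ k * (k : ℚ) ^ m =
      2 * (1 - 2 ^ (m + 1)) * bernoulli (m + 1) + p * z := by
  obtain ⟨h, hh⟩ := (Fact.out : p.Prime).odd_of_ne_two h2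
  have hhQ : (p : ℚ) = 2 * h + 1 := by exact_mod_cast hh
  have i2 := inv_two_mem_pIntegers h2
  obtain ⟨u, hu, hue⟩ := bernoulli_eval_congr (n := m + 1) hm (x := ((h + 1 : ℕ) : ℚ))
    (y := 1 / 2) (natCast_mem _ _) (by simpa using i2) i2 (by rw [hhQ]; push_cast; ring)
  obtain ⟨v, hv, hve⟩ := bernoulli_eval_congr (n := m + 1) hm (x := (p : ℚ)) (y := 0)
    (natCast_mem _ _) (zero_mem _) (one_mem _) (by ring)
  have s1 := Polynomial.sum_range_pow_eq_bernoulli_sub (h + 1) m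
  have s2 := Polynomial.sum_range_pow_eq_bernoulli_sub p m
  have s3 := sum_range_alternating_pow h m
  have s4 := bernoulli_eval_one_half (m + 1)
  rw [← hh] at s3
  rw [Nat.succ_eq_add_one] at s1 s2
  rw [hue] at s1
  rw [hve, Polynomial.bernoulli_eval_zero] at s2
  refine ⟨2 ^ (m + 1) * u - v,
    sub_mem (mul_mem (pow_mem (ofNat_mem _ 2) _) hu) hv, ?_⟩
  rw [s3]
  linear_combination 2 ^ (m + 1) * s1 - s2 + s4

theorem fermat_pIntegers {k a : ℕ} (hk : ¬ p ∣ k) (ha : a ≤ p - 1) :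
    ∃ z ∈ pIntegers p, 1 / (k : ℚ) ^ a = (k : ℚ) ^ (p - 1 - a) + p * z := by
  have hk0 : (k : ℚ) ≠ 0 := by rintro h; simp_all
  have hmod : (k : ℤ) ^ (p - 1) ≡ 1 [ZMOD p] :=
    Int.ModEq.pow_card_sub_one_eq_one Fact.out
      (Nat.isCoprime_iff_coprime.2
        (((Nat.Prime.coprime_iff_not_dvd Fact.out).2 hk).symm))
  obtain ⟨c, hc⟩ := hmod.dvd
  have hcQ : (1 : ℚ) - k ^ (p - 1) = p * c := by exact_mod_cast hc
  refine ⟨c * (k : ℚ)⁻¹ ^ a,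
    mul_mem (intCast_mem _ _) (pow_mem (inv_natCast_mem_pIntegers hk) _), ?_⟩
  have he : (k : ℚ) ^ (p - 1) = k ^ (p - 1 - a) * k ^ a := by
    rw [← pow_add, Nat.sub_add_cancel ha]
  rw [he] at hcQ
  rw [inv_pow]
  field_simp
  linear_combination hcQ

theorem alternating_harmonic_sum_congr {a : ℕ} (ha : 0 < a) (hap : a + 2 ≤ p) :
    ∃ z ∈ pIntegers p, ∑ k ∈ Icc 1 (p - 1), (-1) ^ k / (k : ℚ) ^ a =
      -(2 * (1 - 2 ^ (p - a)) / (a : ℚ)) * bernoulli (p - a) + p * z := by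
  have h1 : ∀ k ∈ Icc 1 (p - 1), ∃ z ∈ pIntegers p,
      (-1) ^ k / (k : ℚ) ^ a = (-1) ^ k * (k : ℚ) ^ (p - 1 - a) + p * z := by
    intro k hk
    obtain ⟨z, hz, hze⟩ := fermat_pIntegers (a := a) (not_dvd_of_mem_Icc hk) (by omega)
    exact ⟨(-1) ^ k * z, mul_mem (pow_mem (neg_mem (one_mem _)) _) hz, by
      rw [div_eq_mul_one_div, hze]; ring⟩
  choose! w hw hwe using h1
  have hW : ∑ k ∈ Icc 1 (p - 1), w k ∈ pIntegers p := sum_mem hw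
  obtain ⟨z, hz, hze⟩ := alternating_power_sum_congr (p := p) (by omega)
    (m := p - 1 - a) (by omega)
  have hr : ∑ k ∈ range p, (-1) ^ k * (k : ℚ) ^ (p - 1 - a) =
      ∑ k ∈ Icc 1 (p - 1), (-1) ^ k * (k : ℚ) ^ (p - 1 - a) := by
    rw [range_eq_Ico, sum_eq_sum_Ico_succ_bot (by omega)]
    have : Icc 1 (p - 1) = Ico (0 + 1) p := by ext; simp; omega
    rw [this, Nat.cast_zero, zero_pow (by omega), mul_zero, zero_add]
  have hA : ∑ k ∈ Icc 1 (p - 1), (-1) ^ k * (k : ℚ) ^ (p - 1 - a) ∈ pIntegers p :=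
    sum_mem fun k _ ↦ mul_mem (pow_mem (neg_mem (one_mem _)) _) (pow_mem (natCast_mem _ _) _)
  have ha' : (a : ℚ)⁻¹ ∈ pIntegers p :=
    inv_natCast_mem_pIntegers (Nat.not_dvd_of_pos_of_lt ha (by omega))
  have ha0 : (a : ℚ) ≠ 0 := by positivity
  rw [sum_congr rfl hwe, sum_add_distrib, ← mul_sum]
  rw [hr, show p - 1 - a + 1 = p - a by omega] at hze
  have hc : ((p - 1 - a : ℕ) : ℚ) + 1 = p - a := by
    rw [← Nat.cast_add_one, show p - 1 - a + 1 = p - a by omega, Nat.cast_sub (by omega)]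
  rw [hc] at hze
  refine ⟨_, add_mem hW (mul_mem ha' (sub_mem hA hz)), ?_⟩
  field_simp
  linear_combination -hze

theorem sq_dvd_add_mul_mul_sub_pow_sub (x y : ℤ) (a : ℕ) :
    y ^ 2 ∣ (x + a * y) * (x - y) ^ a - x ^ (a + 1) := by
  induction a with
  | zero => simp
  | succ a ih =>
    obtain ⟨c, hc⟩ := ih
    exact ⟨x * c - (a + 1) * (x - y) ^ a, by push_cast; linear_combination x * hc⟩

theorem inv_pow_sub_inv_pow_congr {a k : ℕ} (ha : Even a) (hk : k ∈ Icc 1 (p - 1)) :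
    ∃ z ∈ pIntegers p, 1 / (k : ℚ) ^ a - 1 / ((p - k : ℕ) : ℚ) ^ a =
      -(a * p) / (k : ℚ) ^ (a + 1) + (p : ℚ) ^ 2 * z := by
  have hpk : p - k ∈ Icc 1 (p - 1) := by rw [mem_Icc] at *; omega
  have hkp : k ≤ p := by rw [mem_Icc] at hk; omega
  have k0 : (k : ℚ) ≠ 0 := by rw [mem_Icc] at hk; norm_cast; omega
  have d0 : ((p - k : ℕ) : ℚ) ≠ 0 := by rw [mem_Icc] at hpk; norm_cast; omega
  obtain ⟨c, hc⟩ := sq_dvd_add_mul_mul_sub_pow_sub k p a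
  rw [← ha.neg_pow (k - p : ℤ), neg_sub] at hc
  have hcQ : ((k : ℚ) + a * p) * ((p - k : ℕ) : ℚ) ^ a - k ^ (a + 1) = p ^ 2 * c := by
    rw [Nat.cast_sub hkp]; exact_mod_cast hc
  refine ⟨c * ((k : ℚ)⁻¹ ^ (a + 1) * ((p - k : ℕ) : ℚ)⁻¹ ^ a),
    mul_mem (intCast_mem _ _)
      (mul_mem (pow_mem (inv_natCast_mem_pIntegers (not_dvd_of_mem_Icc hk)) _)
        (pow_mem (inv_natCast_mem_pIntegers (not_dvd_of_mem_Icc hpk)) _)), ?_⟩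
  rw [inv_pow, inv_pow]
  have K0 := pow_ne_zero a k0
  have D0 := pow_ne_zero a d0
  rw [pow_succ] at hcQ ⊢
  generalize ((p - k : ℕ) : ℚ) ^ a = D at *
  generalize (k : ℚ) ^ a = K at *
  field_simp
  linear_combination hcQ

theorem alternating_harmonic_sum_congr_sq {a : ℕ} (ha : 0 < a) (hap : a + 2 ≤ p) (hev : Even a) :
    ∃ z ∈ pIntegers p, ∑ k ∈ Icc 1 (p - 1), (-1) ^ k / (k : ℚ) ^ a =
      (a : ℚ) * (1 - 2 ^ (p - 1 - a)) / ((a : ℚ) + 1) * p * bernoulli (p - 1 - a) +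
        (p : ℚ) ^ 2 * z := by
  have h2 : p ≠ 2 := by omega
  have hodd := (Fact.out : p.Prime).odd_of_ne_two h2
  have hap' : a + 1 + 2 ≤ p := by
    obtain ⟨b, hb⟩ := hev
    obtain ⟨c, hc⟩ := hodd
    omega
  choose! w hw hwe using fun k hk ↦ inv_pow_sub_inv_pow_congr (p := p) (k := k) hev hk
  obtain ⟨z, hz, hze⟩ := alternating_harmonic_sum_congr (p := p) (a := a + 1) (by omega) hap'
  have hrefl : ∑ k ∈ Icc 1 (p - 1), (-1) ^ k / (k : ℚ) ^ a =
      ∑ k ∈ Icc 1 (p - 1), -((-1) ^ k / ((p - k : ℕ) : ℚ) ^ a) := by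
    refine sum_bij' (fun k _ ↦ p - k) (fun k _ ↦ p - k) ?_ ?_ ?_ ?_ ?_ <;> intro k hk <;>
      rw [mem_Icc] at hk
    · rw [mem_Icc]; omega
    · rw [mem_Icc]; omega
    · omega
    · omega
    · rw [Nat.sub_sub_self (by omega), ← neg_div]
      congr 1
      have h3 : (-1 : ℚ) ^ (p - k) * (-1) ^ k = -1 := by
        rw [← pow_add, Nat.sub_add_cancel (by omega), hodd.neg_one_pow]
      rcases neg_one_pow_eq_or ℚ k with h | h <;> rw [h] at h3 ⊢ <;> linarith
  have hsum : ∑ k ∈ Icc 1 (p - 1), (-1) ^ k / (k : ℚ) ^ a +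
      ∑ k ∈ Icc 1 (p - 1), -((-1) ^ k / ((p - k : ℕ) : ℚ) ^ a) =
      -(a * p) * ∑ k ∈ Icc 1 (p - 1), (-1) ^ k / (k : ℚ) ^ (a + 1) +
        (p : ℚ) ^ 2 * ∑ k ∈ Icc 1 (p - 1), (-1) ^ k * w k := by
    rw [← sum_add_distrib, mul_sum, mul_sum, ← sum_add_distrib]
    refine sum_congr rfl fun k hk ↦ ?_
    linear_combination (-1) ^ k * hwe k hk
  rw [← hrefl, hze, show p - (a + 1) = p - 1 - a by omega] at hsum
  refine ⟨2⁻¹ * (∑ k ∈ Icc 1 (p - 1), (-1) ^ k * w k - a * z), mul_mem (inv_two_mem_pIntegers h2)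
    (sub_mem (sum_mem fun k hk ↦ mul_mem (pow_mem (neg_mem (one_mem _)) _) (hw k hk))
      (mul_mem (natCast_mem _ _) hz)), ?_⟩
  push_cast at hsum
  linear_combination hsum / 2

end

/-- Corollary: congruence for the depth-one alternating harmonic sum `H(-a; p-1)`. -/
theorem depth_one_AMHS_congruence (a : ℕ) (ha : 0 < a) (p : ℕ) (hp : p.Prime)
    (hpa : a + 2 ≤ p) :
    (Odd a →
      pcong p (H [-(a : ℤ)] (p - 1))
        (-(2 * (1 - 2 ^ (p - a)) / (a : ℚ)) * bernoulli (p - a))) ∧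
    (Even a →
      pcong (p ^ 2) (H [-(a : ℤ)] (p - 1))
        ((a : ℚ) * (1 - 2 ^ (p - 1 - a)) / ((a : ℚ) + 1) * p * bernoulli (p - 1 - a))) := by
  have : Fact p.Prime := ⟨hp⟩
  rw [H_singleton_neg a ha]
  constructor
  · intro _
    obtain ⟨z, hz, h⟩ := alternating_harmonic_sum_congr ha hpa
    have := pcong_of_eq_add (r := 1) hz (h.trans (by rw [pow_one]))
    rwa [pow_one] at this
  · intro hev
    obtain ⟨z, hz, h⟩ := alternating_harmonic_sum_congr_sq ha hpa hev
    exact pcong_of_eq_add hz h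
end

section
/- Let a, \ell be positive integers, s=(s_1,\dots,s_\ell) a tuple of nonzero integers, and s'=(s_2,\dots,s_\ell). For every prime p \ge a+2, writing H(-)=H(-;p-1), one has H(-a,s) \equiv \frac{(1-2^{p-a})B_{p-a}}{p-a}\big(H(s) - H(-s_1, s')\big) - \sum_{k=0}^{p-2-a} \binom{p-1-a}{k} \frac{(1-2^{k+1})B_{k+1}}{k+1}\, H\big((k+a)\oplus(-s_1), s'\big) \pmod{p}. -/
open Finset

/-- Half the value at zero of the `k`-th Euler polynomial. -/
def halfEulerZero (k : ℕ) : ℚ := (1 - 2 ^ (k + 1)) * bernoulli (k + 1) / ((k : ℚ) + 1)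

/-- Half the `m`-th Euler polynomial, as a function. -/
def halfEulerFun (m : ℕ) (x : ℚ) : ℚ :=
  ∑ k ∈ range (m + 1), (m.choose k : ℚ) * halfEulerZero k * x ^ (m - k)

/-- The operator of convolving with a further, larger, summation index of exponent `s`. -/
def outerSum (s : ℤ) : (ℕ → ℚ) →ₗ[ℚ] (ℕ → ℚ) where
  toFun f n := ∑ k ∈ Icc 1 n, (sgn s) ^ k / (k : ℚ) ^ s.natAbs * f (k - 1)
  map_add' f g := by
    ext n
    simp [mul_add, sum_add_distrib]
  map_smul' c f := by
    ext n
    simp [mul_sum, mul_left_comm]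

/-- The composite of the operators `outerSum s` over the entries `s` of the reversed index list `t`. -/
def outerSums : List ℤ → (ℕ → ℚ) →ₗ[ℚ] (ℕ → ℚ)
  | [] => LinearMap.id
  | s :: t => outerSum s ∘ₗ outerSums t

theorem outerSums_cons_apply (s : ℤ) (t : List ℤ) (f : ℕ → ℚ) (n : ℕ) :
    outerSums (s :: t) f n =
      ∑ k ∈ Icc 1 n, (sgn s) ^ k / (k : ℚ) ^ s.natAbs * outerSums t f (k - 1) :=
  rfl

theorem outerSums_Hrev (t u : List ℤ) : outerSums t (Hrev u) = Hrev (t ++ u) := by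
  induction t with
  | nil => rfl
  | cons s t ih =>
    ext n
    simp [outerSums_cons_apply, ih, Hrev]

section EulerGeneratingFunction

open PowerSeries

theorem mk_halfEulerZero_mul_exp_add_one :
    (PowerSeries.mk fun k => halfEulerZero k / (k.factorial : ℚ)) * (exp ℚ + 1) = 1 := by
  set C : ℚ⟦X⟧ := PowerSeries.mk fun k => halfEulerZero k / (k.factorial : ℚ)
  have hC : X * C = bernoulliPowerSeries ℚ - rescale 2 (bernoulliPowerSeries ℚ) := by
    ext n
    cases n with
    | zero =>
      rw [coeff_zero_X_mul, map_sub, coeff_rescale]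
      simp
    | succ n =>
      have h1 : (n : ℚ) + 1 ≠ 0 := by positivity
      have h2 : (n.factorial : ℚ) ≠ 0 := by positivity
      simp only [coeff_succ_X_mul, C, coeff_mk, map_sub, coeff_rescale, bernoulliPowerSeries,
        halfEulerZero, Nat.factorial_succ, Algebra.algebraMap_self, RingHom.id_apply]
      push_cast
      field_simp
  have hB := bernoulliPowerSeries_mul_exp_sub_one ℚ
  have hE : rescale (2 : ℚ) (exp ℚ) = exp ℚ * exp ℚ := by
    have h := exp_mul_exp_eq_exp_add (A := ℚ) 1 1
    rw [rescale_one] at h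
    norm_num at h
    exact h.symm
  have hB2 : rescale 2 (bernoulliPowerSeries ℚ) * (exp ℚ * exp ℚ - 1) = 2 * X := by
    have h := congrArg (rescale (2 : ℚ)) hB
    rw [map_mul, map_sub, map_one, hE, rescale_X] at h
    rw [h]
    rfl
  have hexp : exp ℚ - 1 ≠ 0 := by
    intro h
    rw [h, mul_zero] at hB
    exact X_ne_zero hB.symm
  have key : X * (exp ℚ - 1) * (C * (exp ℚ + 1)) = X * (exp ℚ - 1) * 1 := by
    linear_combination (exp ℚ - 1) * (exp ℚ + 1) * hC + (exp ℚ + 1) * hB - hB2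
  exact mul_left_cancel₀ (mul_ne_zero X_ne_zero hexp) key

theorem mk_halfEulerZero_mul_rescale_exp (x : ℚ) :
    (PowerSeries.mk fun k => halfEulerZero k / (k.factorial : ℚ)) * rescale x (exp ℚ) =
      PowerSeries.mk fun m => halfEulerFun m x / (m.factorial : ℚ) := by
  ext m
  simp only [coeff_mul, coeff_mk, coeff_rescale, coeff_exp, Algebra.algebraMap_self,
    RingHom.id_apply]
  rw [Finset.Nat.sum_antidiagonal_eq_sum_range_succ
    (fun i j => halfEulerZero i / (i.factorial : ℚ) * (x ^ j * (1 / (j.factorial : ℚ)))),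
    halfEulerFun, sum_div]
  refine sum_congr rfl fun k hk => ?_
  have hk : k ≤ m := by simpa [Nat.lt_succ_iff] using hk
  rw [Nat.cast_choose ℚ hk]
  have := Nat.factorial_ne_zero m
  field_simp

theorem halfEulerFun_add_one_add (m : ℕ) (x : ℚ) :
    halfEulerFun m (x + 1) + halfEulerFun m x = x ^ m := by
  have h := congrArg (fun f => coeff m (f * rescale x (exp ℚ))) mk_halfEulerZero_mul_exp_add_one
  have hexp := exp_mul_exp_eq_exp_add (A := ℚ) x 1
  rw [rescale_one, RingHom.id_apply] at hexp
  simp only [mul_add, add_mul, mul_one, one_mul, mul_assoc, mul_comm (exp ℚ), hexp,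
    mk_halfEulerZero_mul_rescale_exp, map_add, coeff_mk, coeff_rescale, coeff_exp,
    Algebra.algebraMap_self, RingHom.id_apply] at h
  have := Nat.factorial_ne_zero m
  field_simp at h
  exact h

end EulerGeneratingFunction

theorem halfEulerFun_zero (m : ℕ) : halfEulerFun m 0 = halfEulerZero m := by
  rw [halfEulerFun, sum_range_succ, sum_eq_zero]
  · simp
  · intro k hk
    have : m - k ≠ 0 := by
      have := mem_range.1 hk
      omega
    simp [this]

theorem halfEulerFun_eq (m : ℕ) (x : ℚ) :
    halfEulerFun m x =
      ∑ k ∈ range m, (m.choose k : ℚ) * halfEulerZero k * x ^ (m - k) + halfEulerZero m := by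
  simp [halfEulerFun, sum_range_succ]

theorem sum_neg_one_pow_mul_pow {m : ℕ} (hm : m ≠ 0) (n : ℕ) :
    ∑ j ∈ Icc 1 n, (-1 : ℚ) ^ j * (j : ℚ) ^ m =
      halfEulerZero m - (-1) ^ (n + 1) * halfEulerFun m (n + 1) := by
  induction n with
  | zero =>
    have h := halfEulerFun_add_one_add m 0
    rw [halfEulerFun_zero, zero_pow hm] at h
    simp only [zero_add] at h
    simp
    linarith
  | succ n ih =>
    have h := halfEulerFun_add_one_add m (n + 1)
    rw [sum_Icc_succ_top (by omega), ih]
    push_cast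
    rw [← h]
    ring

section Padic

variable {p : ℕ} [Fact p.Prime]

theorem pcong_of_padicNorm_sub_lt_one {x y : ℚ} (h : padicNorm p (x - y) < 1) : pcong p x y := by
  rw [pcong, ← padicNorm.int_lt_one_iff]
  rw [← Rat.mul_den_eq_num, padicNorm.mul]
  exact mul_lt_one_of_nonneg_of_lt_one_left (padicNorm.nonneg _) h (padicNorm.of_nat _)

theorem padicNorm_natCast_eq_one_of_pos_of_lt {k : ℕ} (h0 : 0 < k) (hk : k < p) :
    padicNorm p k = 1 :=
  (padicNorm.nat_eq_one_iff k).2 (Nat.not_dvd_of_pos_of_lt h0 hk)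

theorem padicNorm_pow (x : ℚ) (n : ℕ) : padicNorm p (x ^ n) = padicNorm p x ^ n := by
  induction n with
  | zero => simp
  | succ n ih => rw [pow_succ, pow_succ, padicNorm.mul, ih]

theorem padicNorm_neg_one_pow (n : ℕ) : padicNorm p ((-1) ^ n) = 1 := by
  simp

theorem padicNorm_sgn_pow_div (s : ℤ) {k : ℕ} (h0 : 0 < k) (hk : k < p) (e : ℕ) :
    padicNorm p (sgn s ^ k / (k : ℚ) ^ e) = 1 := by
  have hs : padicNorm p (sgn s) = 1 := by
    unfold sgn
    split_ifs <;> simp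
  rw [padicNorm.div, padicNorm_pow, padicNorm_pow, hs,
    padicNorm_natCast_eq_one_of_pos_of_lt h0 hk]
  simp

theorem padicNorm_outerSums_lt_one {f : ℕ → ℚ} (hf : ∀ n < p, padicNorm p (f n) < 1)
    (t : List ℤ) : ∀ n < p, padicNorm p (outerSums t f n) < 1 := by
  induction t with
  | nil => exact hf
  | cons s t ih =>
    intro n hn
    rw [outerSums_cons_apply]
    refine padicNorm.sum_lt' (fun k hk => ?_) one_pos
    obtain ⟨h1, h2⟩ := mem_Icc.1 hk
    rw [padicNorm.mul, padicNorm_sgn_pow_div s h1 (by omega), one_mul]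
    exact ih _ (by omega)

theorem padicNorm_halfEulerZero_le_one (hp : p ≠ 2) (m : ℕ) :
    padicNorm p (halfEulerZero m) ≤ 1 := by
  have h2 : padicNorm p 2 = 1 :=
    mod_cast padicNorm_natCast_eq_one_of_pos_of_lt (p := p) (k := 2) (by norm_num)
      (lt_of_le_of_ne (Fact.out : p.Prime).two_le hp.symm)
  induction m using Nat.strong_induction_on with
  | _ m ih =>
    have h := halfEulerFun_add_one_add m 0
    rw [halfEulerFun_zero, halfEulerFun_eq] at h
    have h' : 2 * halfEulerZero m = ((0 ^ m : ℕ) : ℚ) -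
        ∑ k ∈ range m, (m.choose k : ℚ) * halfEulerZero k := by
      push_cast
      rw [← h]
      simp only [zero_add, one_pow, mul_one]
      ring
    have hnorm : padicNorm p (halfEulerZero m) = padicNorm p (2 * halfEulerZero m) := by
      rw [padicNorm.mul, h2, one_mul]
    rw [hnorm, h']
    refine padicNorm.sub.trans (max_le (padicNorm.of_nat _) ?_)
    refine padicNorm.sum_le' (fun k hk => ?_) zero_le_one
    rw [padicNorm.mul]
    exact mul_le_one₀ (padicNorm.of_nat _) (padicNorm.nonneg _) (ih k (mem_range.1 hk))

theorem padicNorm_one_div_pow_sub_pow_lt_one {k : ℕ} (h0 : 0 < k) (hk : k < p) {e f : ℕ}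
    (hef : e + f = p - 1) : padicNorm p (1 / (k : ℚ) ^ e - (k : ℚ) ^ f) < 1 := by
  have hk0 : (k : ℚ) ≠ 0 := by positivity
  have h : 1 / (k : ℚ) ^ e - (k : ℚ) ^ f = ((1 - (k : ℤ) ^ (p - 1) : ℤ) : ℚ) / (k : ℚ) ^ e := by
    push_cast
    rw [← hef, pow_add]
    field_simp
  rw [h, padicNorm.div, padicNorm_pow, padicNorm_natCast_eq_one_of_pos_of_lt h0 hk, one_pow,
    div_one, padicNorm.int_lt_one_iff]
  refine (Int.ModEq.pow_card_sub_one_eq_one (Fact.out : p.Prime) ?_).dvd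
  rw [Int.isCoprime_iff_gcd_eq_one, Int.gcd_natCast_natCast]
  exact (Nat.coprime_of_lt_prime h0.ne' hk Fact.out).symm

end Padic

theorem sgn_neg {s : ℤ} (hs : s ≠ 0) : sgn (-s) = -sgn s := by
  unfold sgn
  split_ifs <;> first | omega | norm_num

theorem sgn_oplus_neg {c s : ℤ} (hc : 0 < c) (hs : s ≠ 0) : sgn (oplus c (-s)) = -sgn s := by
  have h : 0 < |c| + |-s| := by positivity
  rw [← sgn_neg hs, oplus, if_neg hc.ne', if_neg (neg_ne_zero.2 hs), Int.sign_mul,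
    Int.sign_eq_one_of_pos hc, one_mul]
  unfold sgn
  rcases lt_or_gt_of_ne (neg_ne_zero.2 hs) with h' | h'
  · rw [Int.sign_eq_neg_one_of_neg h', if_pos (by linarith), if_pos h']
  · rw [Int.sign_eq_one_of_pos h', if_neg (by linarith), if_neg (by linarith)]

theorem natAbs_oplus_neg {c s : ℤ} (hc : 0 < c) (hs : s ≠ 0) :
    (oplus c (-s)).natAbs = c.natAbs + s.natAbs := by
  rw [oplus, if_neg hc.ne', if_neg (neg_ne_zero.2 hs), Int.natAbs_mul, Int.natAbs_sign_of_ne_zero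
    (mul_ne_zero hc.ne' (neg_ne_zero.2 hs)), one_mul, abs_neg, Int.abs_eq_natAbs,
    Int.abs_eq_natAbs]
  omega

/-- The difference of the two sides of the reduction formula for an index list of length two. -/
def reductionDefect (a : ℕ) (s : ℤ) (p : ℕ) : ℕ → ℚ :=
  Hrev [s, -(a : ℤ)] - (halfEulerZero (p - 1 - a) • (Hrev [s] - Hrev [-s]) -
    ∑ k ∈ range (p - 1 - a), ((p - 1 - a).choose k * halfEulerZero k : ℚ) •
      Hrev [oplus ((k : ℤ) + a) (-s)])

theorem reductionDefect_eq {a : ℕ} (ha : 0 < a) {s : ℤ} (hs : s ≠ 0) {p : ℕ} (hpa : a + 2 ≤ p)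
    (n : ℕ) : reductionDefect a s p n = ∑ k ∈ Icc 1 n, sgn s ^ k / (k : ℚ) ^ s.natAbs *
      (∑ j ∈ Icc 1 (k - 1), (-1) ^ j * (1 / (j : ℚ) ^ a - (j : ℚ) ^ (p - 1 - a)) +
        ∑ i ∈ range (p - 1 - a), (-1) ^ k * ((p - 1 - a).choose i * halfEulerZero i) *
          (1 / (k : ℚ) ^ (i + a) - (k : ℚ) ^ (p - 1 - a - i))) := by
  set m := p - 1 - a
  simp only [reductionDefect, Pi.sub_apply, Pi.smul_apply, Finset.sum_apply, smul_eq_mul, Hrev,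
    mul_one]
  have hcomm (c : ℕ → ℚ) (g : ℕ → ℕ → ℚ) :
      ∑ i ∈ range m, c i * ∑ k ∈ Icc 1 n, g i k =
        ∑ k ∈ Icc 1 n, ∑ i ∈ range m, c i * g i k := by
    simp only [mul_sum]
    exact sum_comm
  rw [hcomm, ← sum_sub_distrib, mul_sum, ← sum_sub_distrib, ← sum_sub_distrib]
  refine sum_congr rfl fun k hk => ?_
  have hk1 := (mem_Icc.1 hk).1
  have hsum := sum_neg_one_pow_mul_pow (show m ≠ 0 by omega) (k - 1)
  rw [Nat.sub_add_cancel hk1, Nat.cast_sub hk1, Nat.cast_one, sub_add_cancel,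
    halfEulerFun_eq] at hsum
  have hneg : sgn (-(a : ℤ)) = -1 := by
    rw [sgn, if_pos (by omega)]
  have hterm (i : ℕ) : sgn (oplus ((i : ℤ) + a) (-s)) ^ k /
      (k : ℚ) ^ (oplus ((i : ℤ) + a) (-s)).natAbs =
        sgn s ^ k / (k : ℚ) ^ s.natAbs * ((-1) ^ k * (1 / (k : ℚ) ^ (i + a))) := by
    have hia : (0 : ℤ) < (i : ℤ) + a := by omega
    rw [sgn_oplus_neg hia hs, natAbs_oplus_neg hia hs, neg_pow,
      show ((i : ℤ) + a).natAbs = i + a by omega, pow_add]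
    field_simp
  simp only [hterm, hneg, sgn_neg hs, Int.natAbs_neg, Int.natAbs_natCast, mul_sub,
    sum_sub_distrib, hsum]
  rw [neg_pow (sgn s) k]
  have e1 : ∑ i ∈ range m, (m.choose i : ℚ) * halfEulerZero i *
      (sgn s ^ k / (k : ℚ) ^ s.natAbs * ((-1) ^ k * (1 / (k : ℚ) ^ (i + a)))) =
      sgn s ^ k / (k : ℚ) ^ s.natAbs * ∑ i ∈ range m,
        (-1) ^ k * ((m.choose i : ℚ) * halfEulerZero i) * (1 / (k : ℚ) ^ (i + a)) := by
    rw [mul_sum]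
    exact sum_congr rfl fun i _ => by ring
  have e2 : ∑ i ∈ range m, (-1) ^ k * ((m.choose i : ℚ) * halfEulerZero i) * (k : ℚ) ^ (m - i) =
      (-1) ^ k * ∑ i ∈ range m, (m.choose i : ℚ) * halfEulerZero i * (k : ℚ) ^ (m - i) := by
    rw [mul_sum]
    exact sum_congr rfl fun i _ => by ring
  rw [e1, e2]
  simp only [mul_one_div]
  ring

theorem padicNorm_reductionDefect_lt_one {a : ℕ} (ha : 0 < a) {s : ℤ} (hs : s ≠ 0) {p : ℕ}
    [Fact p.Prime] (hpa : a + 2 ≤ p) (n : ℕ) (hn : n < p) :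
    padicNorm p (reductionDefect a s p n) < 1 := by
  rw [reductionDefect_eq ha hs hpa]
  refine padicNorm.sum_lt' (fun k hk => ?_) one_pos
  obtain ⟨h1, h2⟩ := mem_Icc.1 hk
  rw [padicNorm.mul, padicNorm_sgn_pow_div s h1 (by omega), one_mul]
  refine padicNorm.nonarchimedean.trans_lt (max_lt ?_ ?_)
  · refine padicNorm.sum_lt' (fun j hj => ?_) one_pos
    obtain ⟨h3, h4⟩ := mem_Icc.1 hj
    rw [padicNorm.mul, padicNorm_neg_one_pow, one_mul]
    exact padicNorm_one_div_pow_sub_pow_lt_one h3 (by omega) (by omega)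
  · refine padicNorm.sum_lt' (fun i hi => ?_) one_pos
    have hi := mem_range.1 hi
    rw [padicNorm.mul, padicNorm.mul, padicNorm_neg_one_pow, one_mul, padicNorm.mul]
    refine mul_lt_one_of_nonneg_of_lt_one_right ?_ (padicNorm.nonneg _)
      (padicNorm_one_div_pow_sub_pow_lt_one h1 (by omega) (by omega))
    exact mul_le_one₀ (padicNorm.of_nat _) (padicNorm.nonneg _)
      (padicNorm_halfEulerZero_le_one (by omega) i)

/-- Second reduction formula (Theorem for `H(-a, s)` with negative leading entry). -/
theorem reduction_formula_negative (a : ℕ) (ha : 0 < a) (s1 : ℤ) (hs1 : s1 ≠ 0)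
    (s' : List ℤ) (hs' : ∀ t ∈ s', t ≠ 0) (p : ℕ) (hp : p.Prime) (hpa : a + 2 ≤ p) :
    pcong p (H (-(a : ℤ) :: s1 :: s') (p - 1))
      ((1 - 2 ^ (p - a)) * bernoulli (p - a) / ((p : ℚ) - a) *
          (H (s1 :: s') (p - 1) - H (-s1 :: s') (p - 1)) -
        ∑ k ∈ Finset.range (p - 1 - a),
          (Nat.choose (p - 1 - a) k : ℚ) *
            ((1 - 2 ^ (k + 1)) * bernoulli (k + 1) / ((k : ℚ) + 1)) *
            H (oplus ((k : ℤ) + a) (-s1) :: s') (p - 1)) := by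
  have : Fact p.Prime := ⟨hp⟩
  apply pcong_of_padicNorm_sub_lt_one
  have h := padicNorm_outerSums_lt_one
    (padicNorm_reductionDefect_lt_one ha hs1 hpa) s'.reverse (p - 1) (by omega)
  rw [reductionDefect] at h
  simp only [map_sub, map_sum, map_smul, outerSums_Hrev, Pi.sub_apply, Finset.sum_apply,
    Pi.smul_apply, smul_eq_mul] at h
  have hc : (1 - 2 ^ (p - a)) * bernoulli (p - a) / ((p : ℚ) - a) = halfEulerZero (p - 1 - a) := by
    rw [halfEulerZero, show p - 1 - a + 1 = p - a by omega]
    rw [← Nat.cast_add_one, show p - 1 - a + 1 = p - a by omega, Nat.cast_sub (by omega)]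
  rw [hc]
  simpa only [H, List.reverse_cons, List.append_assoc, List.cons_append, List.nil_append,
    halfEulerZero] using h
end

section
/- Let a,b be positive integers with a+b even and let p be a prime with p \ge a+b+2. Writing H(-)=H(-;p-1) and S(-)=S(-;p-1), one has S(a,b) \equiv H(a,b) \equiv 0 \pmod{p} and S(-a,-b) \equiv H(-a,-b) \equiv \frac{2(1-2^{p-a})(1-2^{p-b})}{ab} B_{p-a} B_{p-b} \pmod{p}. -/
open Finset

section BernoulliDuplication

open Polynomial

theorem polynomial_eq_C_of_eval_one_add {f : ℚ[X]} (hf : ∀ x, f.eval (1 + x) = f.eval x) :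
    f = C (f.eval 0) := by
  have hnat : ∀ k : ℕ, f.eval (k : ℚ) = f.eval 0 := by
    intro k
    induction k with
    | zero => simp
    | succ k ih => rw [Nat.cast_succ, add_comm, hf, ih]
  refine eq_of_infinite_eval_eq f _ ((Set.infinite_range_of_injective
    (Nat.cast_injective (R := ℚ))).mono ?_)
  rintro _ ⟨k, rfl⟩
  simp [hnat k]

/-- The difference of the two sides of the duplication formula for Bernoulli polynomials. -/
noncomputable def bernoulliDuplicationDefect (n : ℕ) : ℚ[X] :=
  C 2 * Polynomial.bernoulli n - C (2 ^ n) * ((Polynomial.bernoulli n).comp (C (1 / 2) * X) +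
    (Polynomial.bernoulli n).comp (C (1 / 2) * X + C (1 / 2)))

theorem bernoulliDuplicationDefect_eval (n : ℕ) (x : ℚ) :
    (bernoulliDuplicationDefect n).eval x = 2 * (Polynomial.bernoulli n).eval x -
      2 ^ n * ((Polynomial.bernoulli n).eval (x / 2) +
        (Polynomial.bernoulli n).eval ((1 + x) / 2)) := by
  simp only [bernoulliDuplicationDefect, eval_sub, eval_mul, eval_C, eval_add, eval_comp, eval_X]
  ring_nf

theorem derivative_bernoulliDuplicationDefect (n : ℕ) :
    derivative (bernoulliDuplicationDefect (n + 1)) =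
      C (n + 1 : ℚ) * bernoulliDuplicationDefect n := by
  apply Polynomial.funext
  intro x
  simp only [bernoulliDuplicationDefect, derivative_sub, derivative_mul, derivative_add,
    derivative_comp, derivative_bernoulli_add_one, derivative_C, derivative_X, eval_sub, eval_mul,
    eval_C, eval_add, eval_comp, eval_X, eval_natCast, eval_one, eval_zero, mul_comp, add_comp,
    natCast_comp, one_comp]
  ring

theorem bernoulliDuplicationDefect_eval_one_add (n : ℕ) (x : ℚ) :
    (bernoulliDuplicationDefect (n + 1)).eval (1 + x) =
      (bernoulliDuplicationDefect (n + 1)).eval x := by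
  have h : (1 + (1 + x)) / 2 = 1 + x / 2 := by ring
  simp only [bernoulliDuplicationDefect_eval, h, bernoulli_eval_one_add, Nat.add_sub_cancel,
    div_pow]
  field_simp
  ring

theorem bernoulliDuplicationDefect_eq_zero (n : ℕ) : bernoulliDuplicationDefect n = 0 := by
  have h := derivative_bernoulliDuplicationDefect n
  rw [polynomial_eq_C_of_eval_one_add (bernoulliDuplicationDefect_eval_one_add n),
    derivative_C] at h
  exact (mul_eq_zero.mp h.symm).resolve_left (C_ne_zero.mpr (by positivity))

/-- The Euler polynomial of degree `n - 1`, multiplied by `n / 2`. -/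
noncomputable def scaledEuler (n : ℕ) (x : ℚ) : ℚ :=
  (Polynomial.bernoulli n).eval x - 2 ^ n * (Polynomial.bernoulli n).eval (x / 2)

theorem scaledEuler_add_one_add (n : ℕ) (x : ℚ) :
    scaledEuler n (1 + x) + scaledEuler n x = n * x ^ (n - 1) := by
  have h := bernoulliDuplicationDefect_eval n x
  rw [bernoulliDuplicationDefect_eq_zero, eval_zero] at h
  have h1 := bernoulli_eval_one_add n x
  unfold scaledEuler
  linarith

theorem mul_alternating_sum_range_pow (n N : ℕ) :
    n * ∑ k ∈ range N, (-1 : ℚ) ^ k * (k : ℚ) ^ (n - 1) =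
      scaledEuler n 0 - (-1) ^ N * scaledEuler n N := by
  induction N with
  | zero => simp
  | succ N ih =>
    have h := scaledEuler_add_one_add n N
    rw [sum_range_succ, mul_add, ih, Nat.cast_succ, add_comm (N : ℚ) 1, pow_succ]
    linear_combination -(-1 : ℚ) ^ N * h

theorem scaledEuler_eq_sum (n : ℕ) (x : ℚ) :
    scaledEuler n x = ∑ i ∈ range (n + 1),
      (1 - 2 ^ (n - i)) * _root_.bernoulli (n - i) * n.choose i * x ^ i := by
  simp only [scaledEuler, Polynomial.bernoulli, eval_finsetSum, eval_monomial, mul_sum]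
  rw [← sum_sub_distrib, ← sum_range_reflect]
  refine sum_congr rfl fun i hi => ?_
  have hi : i ≤ n := by simpa [Nat.lt_succ_iff] using hi
  have hn : n + 1 - 1 - i = n - i := by omega
  have h2 : (2 : ℚ) ^ n = 2 ^ (n - i) * 2 ^ i := by rw [← pow_add, Nat.sub_add_cancel hi]
  rw [hn, Nat.sub_sub_self hi, Nat.choose_symm hi, div_pow, h2]
  field_simp

end BernoulliDuplication

section DoubleSums

variable {R : Type*} [CommRing R]

theorem sum_mul_sum_Icc_eq (f g : ℕ → R) (n : ℕ) :
    (∑ k ∈ Icc 1 n, f k) * ∑ k ∈ Icc 1 n, g k =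
      ∑ k ∈ Icc 1 n, g k * ∑ j ∈ Icc 1 (k - 1), f j +
        ∑ k ∈ Icc 1 n, f k * ∑ j ∈ Icc 1 (k - 1), g j + ∑ k ∈ Icc 1 n, f k * g k := by
  induction n with
  | zero => simp
  | succ n ih =>
    simp only [sum_Icc_succ_top (Nat.le_add_left 1 n), Nat.add_sub_cancel]
    linear_combination ih

theorem sum_mul_sum_Icc_reflect (f g : ℕ → R) (n : ℕ) :
    ∑ k ∈ Icc 1 n, g k * ∑ j ∈ Icc 1 (k - 1), f j =
      ∑ k ∈ Icc 1 n, f (n + 1 - k) * ∑ j ∈ Icc 1 (k - 1), g (n + 1 - j) := by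
  simp only [mul_sum, sum_sigma']
  refine sum_bij' (fun x _ => ⟨n + 1 - x.2, n + 1 - x.1⟩) (fun x _ => ⟨n + 1 - x.2, n + 1 - x.1⟩)
    ?_ ?_ ?_ ?_ ?_
  · rintro ⟨k, j⟩ h
    simp only [mem_sigma, mem_Icc] at h ⊢
    omega
  · rintro ⟨k, j⟩ h
    simp only [mem_sigma, mem_Icc] at h ⊢
    omega
  · rintro ⟨k, j⟩ h
    simp only [mem_sigma, mem_Icc] at h
    simp only [Sigma.mk.injEq, heq_eq_eq]
    omega
  · rintro ⟨k, j⟩ h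
    simp only [mem_sigma, mem_Icc] at h
    simp only [Sigma.mk.injEq, heq_eq_eq]
    omega
  · rintro ⟨k, j⟩ h
    simp only [mem_sigma, mem_Icc] at h
    have h1 : n + 1 - (n + 1 - k) = k := by omega
    have h2 : n + 1 - (n + 1 - j) = j := by omega
    simp only [h1, h2]
    ring

end DoubleSums

section Congruence

theorem pcong.refl {p : ℕ} (x : ℚ) : pcong p x x := by simp [pcong]

variable {p : ℕ} [Fact p.Prime]

theorem pcong_iff {x y : ℚ} : pcong p x y ↔ padicNorm p (x - y) < 1 := by
  have hx : ((x - y).num : ℚ) = (x - y) * (x - y).den := (Rat.mul_den_eq_num _).symm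
  rw [pcong, ← padicNorm.int_lt_one_iff, hx, padicNorm.mul]
  refine ⟨fun h => ?_, fun h => mul_lt_one_of_nonneg_of_lt_one_left (padicNorm.nonneg _) h
    (padicNorm.of_nat _)⟩
  by_contra! h'
  by_cases hd : p ∣ (x - y).den
  · have hn : (p : ℤ) ∣ (x - y).num := by
      rwa [← padicNorm.int_lt_one_iff, hx, padicNorm.mul]
    have := Nat.dvd_gcd (Int.natCast_dvd.mp hn) hd
    rw [(x - y).reduced] at this
    exact (Fact.out : p.Prime).one_lt.ne' (Nat.dvd_one.mp this)
  · rw [(padicNorm.nat_eq_one_iff _).mpr hd, mul_one] at h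
    exact h'.not_gt h

theorem padicNorm_mul_le_one {x y : ℚ} (hx : padicNorm p x ≤ 1) (hy : padicNorm p y ≤ 1) :
    padicNorm p (x * y) ≤ 1 := by
  rw [padicNorm.mul]
  exact mul_le_one₀ hx (padicNorm.nonneg y) hy

theorem pcong.symm {x y : ℚ} (h : pcong p x y) : pcong p y x := by
  rw [pcong_iff, ← padicNorm.neg, neg_sub]
  exact pcong_iff.mp h

theorem pcong.add {x y z w : ℚ} (h : pcong p x y) (h' : pcong p z w) :
    pcong p (x + z) (y + w) := by
  rw [pcong_iff, add_sub_add_comm]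
  exact padicNorm.nonarchimedean.trans_lt (max_lt (pcong_iff.mp h) (pcong_iff.mp h'))

theorem pcong.trans {x y z : ℚ} (h : pcong p x y) (h' : pcong p y z) : pcong p x z := by
  have := pcong_iff.mp (h.add h')
  rw [pcong_iff]
  convert this using 2
  ring

theorem pcong.mul_left {x y c : ℚ} (hc : padicNorm p c ≤ 1) (h : pcong p x y) :
    pcong p (c * x) (c * y) := by
  rw [pcong_iff, ← mul_sub, padicNorm.mul]
  exact mul_lt_one_of_nonneg_of_lt_one_right hc (padicNorm.nonneg _) (pcong_iff.mp h)

theorem pcong.mul {x y z w : ℚ} (hx : padicNorm p x ≤ 1) (hw : padicNorm p w ≤ 1)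
    (h : pcong p x y) (h' : pcong p z w) : pcong p (x * z) (y * w) := by
  refine (h'.mul_left hx).trans ?_
  rw [mul_comm x, mul_comm y]
  exact h.mul_left hw

theorem pcong.of_mul_left {x y c : ℚ} (hc : padicNorm p c = 1) (h : pcong p (c * x) (c * y)) :
    pcong p x y := by
  rw [pcong_iff, ← mul_sub, padicNorm.mul, hc, one_mul] at h
  exact pcong_iff.mpr h

theorem pcong.pow {x y : ℚ} (hx : padicNorm p x ≤ 1) (hy : padicNorm p y ≤ 1) (h : pcong p x y)
    (n : ℕ) : pcong p (x ^ n) (y ^ n) := by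
  induction n with
  | zero => simpa using pcong.refl 1
  | succ n ih =>
    rw [pow_succ, pow_succ, mul_comm, mul_comm _ y]
    refine h.mul hx ?_ ih
    rw [padicNorm_pow]
    exact pow_le_one₀ (padicNorm.nonneg _) hy

theorem pcong.sum {ι : Type*} {s : Finset ι} {f g : ι → ℚ} (h : ∀ i ∈ s, pcong p (f i) (g i)) :
    pcong p (∑ i ∈ s, f i) (∑ i ∈ s, g i) := by
  rw [pcong_iff, ← sum_sub_distrib]
  exact padicNorm.sum_lt' (fun i hi => pcong_iff.mp (h i hi)) one_pos

theorem padicNorm_natCast_eq_one {k : ℕ} (hk : 0 < k) (hkp : k < p) :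
    padicNorm p (k : ℚ) = 1 :=
  (padicNorm.nat_eq_one_iff k).mpr (Nat.not_dvd_of_pos_of_lt hk hkp)

theorem padicNorm_bernoulli'_le_one {n : ℕ} (hn : n + 1 < p) : padicNorm p (bernoulli' n) ≤ 1 := by
  induction n using Nat.strong_induction_on with
  | _ n ih =>
    rw [bernoulli'_def]
    refine padicNorm.sub.trans (max_le (by simp) (padicNorm.sum_le' (fun k hk => ?_) zero_le_one))
    have hk : k < n := mem_range.mp hk
    have hd : ((n : ℚ) - k + 1) = ((n - k + 1 : ℕ) : ℚ) := by push_cast [hk.le]; ring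
    refine padicNorm_mul_le_one ?_ (ih k hk (by omega))
    have h1 : padicNorm p ((n - k + 1 : ℕ) : ℚ) = 1 :=
      padicNorm_natCast_eq_one (by omega) (by omega)
    rw [padicNorm.div, hd, h1, div_one]
    exact padicNorm.of_nat _

theorem padicNorm_bernoulli_le_one {n : ℕ} (hn : n + 1 < p) : padicNorm p (bernoulli n) ≤ 1 := by
  have h : padicNorm p ((-1) ^ n) = 1 := by simp
  rw [bernoulli, padicNorm.mul, h, one_mul]
  exact padicNorm_bernoulli'_le_one hn

theorem padicNorm_mul_prime_pow_lt_one {x : ℚ} (hx : padicNorm p x ≤ 1) {i : ℕ} (hi : i ≠ 0) :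
    padicNorm p (x * (p : ℚ) ^ i) < 1 := by
  rw [padicNorm.mul, padicNorm_pow]
  exact mul_lt_one_of_nonneg_of_lt_one_right hx (pow_nonneg (padicNorm.nonneg _) _)
    (pow_lt_one₀ (padicNorm.nonneg _) padicNorm.padicNorm_p_lt_one_of_prime hi)

theorem pcong_scaledEuler_prime {n : ℕ} (hn : n < p) :
    pcong p (scaledEuler n p) ((1 - 2 ^ n) * bernoulli n) := by
  rw [pcong_iff, scaledEuler_eq_sum, sum_range_succ']
  simp only [Nat.sub_zero, Nat.choose_zero_right, Nat.cast_one, mul_one, pow_zero,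
    add_sub_cancel_right]
  refine padicNorm.sum_lt' (fun i hi => ?_) one_pos
  have hi : i < n := mem_range.mp hi
  refine padicNorm_mul_prime_pow_lt_one ?_ i.succ_ne_zero
  have h2 : padicNorm p (1 - 2 ^ (n - (i + 1))) ≤ 1 := by
    exact_mod_cast padicNorm.of_int (1 - 2 ^ (n - (i + 1)))
  exact padicNorm_mul_le_one (padicNorm_mul_le_one h2 (padicNorm_bernoulli_le_one (by omega)))
    (padicNorm.of_nat _)

theorem pcong_mul_alternating_sum_range_pow (hp : Odd p) {n : ℕ} (hn : n < p) :
    pcong p (n * ∑ k ∈ range p, (-1 : ℚ) ^ k * (k : ℚ) ^ (n - 1))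
      (2 * (1 - 2 ^ n) * bernoulli n) := by
  rw [mul_alternating_sum_range_pow, hp.neg_one_pow]
  have h0 : scaledEuler n 0 = (1 - 2 ^ n) * bernoulli n := by simp [scaledEuler]; ring
  have := (pcong.refl (scaledEuler n 0)).add (pcong_scaledEuler_prime hn)
  rw [h0] at this ⊢
  convert this using 1 <;> ring

theorem pcong_sum_range_pow {m : ℕ} (hm : m + 1 < p) :
    pcong p (∑ k ∈ range p, (k : ℚ) ^ m) 0 := by
  rw [pcong_iff, sub_zero, sum_range_pow]
  refine padicNorm.sum_lt' (fun i hi => ?_) one_pos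
  have hi : i < m + 1 := mem_range.mp hi
  rw [mul_div_right_comm]
  refine padicNorm_mul_prime_pow_lt_one ?_ (by omega)
  have hd : ((m : ℚ) + 1) = ((m + 1 : ℕ) : ℚ) := by push_cast; ring
  rw [padicNorm.div, hd, padicNorm_natCast_eq_one (by omega) hm, div_one]
  exact padicNorm_mul_le_one (padicNorm_bernoulli_le_one (by omega)) (padicNorm.of_nat _)

theorem pcong_pow_one_div_pow {a m k : ℕ} (ham : m + a = p - 1) (hk : 0 < k) (hkp : k < p) :
    pcong p ((k : ℚ) ^ m) (1 / (k : ℚ) ^ a) := by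
  have hk0 : (k : ℚ) ≠ 0 := by positivity
  have h : (p : ℤ) ∣ (k : ℤ) ^ (p - 1) - 1 := by
    refine (Int.ModEq.pow_card_sub_one_eq_one Fact.out ?_).symm.dvd
    exact Nat.isCoprime_iff_coprime.mpr
      (Nat.coprime_of_lt_prime hk.ne' hkp Fact.out).symm
  rw [← padicNorm.int_lt_one_iff] at h
  refine pcong.of_mul_left (c := (k : ℚ) ^ a) ?_ ?_
  · rw [padicNorm_pow, padicNorm_natCast_eq_one hk hkp, one_pow]
  · rw [mul_one_div_cancel (pow_ne_zero _ hk0), ← pow_add, add_comm, ham, pcong_iff]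
    exact_mod_cast h

theorem padicNorm_pow_div_pow_le_one {c : ℚ} (hc : c = 1 ∨ c = -1) (a : ℕ) {k : ℕ}
    (hk : k ∈ Icc 1 (p - 1)) : padicNorm p (c ^ k / (k : ℚ) ^ a) ≤ 1 := by
  have hk := mem_Icc.mp hk
  have hc' : padicNorm p c = 1 := by rcases hc with rfl | rfl <;> simp
  rw [padicNorm.div, padicNorm_pow, padicNorm_pow, hc', padicNorm_natCast_eq_one (by omega)
    (by omega)]
  simp

theorem sum_range_eq_sum_Icc {f : ℕ → ℚ} (hf : f 0 = 0) {n : ℕ} (hn : 0 < n) :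
    ∑ k ∈ range n, f k = ∑ k ∈ Icc 1 (n - 1), f k := by
  obtain ⟨m, rfl⟩ := Nat.exists_eq_succ_of_ne_zero hn.ne'
  rw [range_eq_Ico, sum_eq_sum_Ico_succ_bot hn, hf, zero_add]
  rfl

theorem pcong_sum_pow_div_pow {c : ℚ} (hc : c = 1 ∨ c = -1) {a : ℕ} (ha : a + 1 < p) :
    pcong p (∑ k ∈ Icc 1 (p - 1), c ^ k / (k : ℚ) ^ a)
      (∑ k ∈ range p, c ^ k * (k : ℚ) ^ (p - a - 1)) := by
  have hm : p - a - 1 ≠ 0 := by omega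
  rw [sum_range_eq_sum_Icc (by simp [hm]) (by omega)]
  refine pcong.sum fun k hk => ?_
  have hc' := padicNorm_pow_div_pow_le_one hc 0 hk
  rw [pow_zero, div_one] at hc'
  have hk := mem_Icc.mp hk
  rw [div_eq_mul_one_div]
  exact ((pcong_pow_one_div_pow (by omega) (by omega) (by omega)).mul_left hc').symm

theorem pcong_sum_one_div_pow {a : ℕ} (ha : 0 < a) (hap : a + 1 < p) :
    pcong p (∑ k ∈ Icc 1 (p - 1), (1 : ℚ) ^ k / (k : ℚ) ^ a) 0 := by
  refine (pcong_sum_pow_div_pow (Or.inl rfl) hap).trans ?_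
  simpa using pcong_sum_range_pow (m := p - a - 1) (by omega)

theorem pcong_alternating_sum_one_div_pow (hp : Odd p) {a : ℕ} (ha : 0 < a) (hap : a + 1 < p) :
    pcong p (∑ k ∈ Icc 1 (p - 1), (-1 : ℚ) ^ k / (k : ℚ) ^ a)
      (-(2 * (1 - 2 ^ (p - a)) * bernoulli (p - a) / a)) := by
  have ha0 : (a : ℚ) ≠ 0 := by positivity
  have hnorm : padicNorm p (∑ k ∈ Icc 1 (p - 1), (-1 : ℚ) ^ k / (k : ℚ) ^ a) ≤ 1 :=
    padicNorm.sum_le' (fun k hk => padicNorm_pow_div_pow_le_one (Or.inr rfl) a hk) zero_le_one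
  have hn : ((p - a : ℕ) : ℚ) = p - a := Nat.cast_sub (by omega)
  have h1 := (pcong_sum_pow_div_pow (p := p) (Or.inr rfl) hap).mul_left
    (padicNorm.of_nat (p - a))
  have h2 := h1.trans (pcong_mul_alternating_sum_range_pow hp (by omega))
  refine pcong.of_mul_left (c := -(a : ℚ)) ?_ (pcong.trans (pcong_iff.mpr ?_) (h2.trans ?_))
  · rw [padicNorm.neg, padicNorm_natCast_eq_one ha (by omega)]
  · rw [← sub_mul, hn, sub_sub_eq_add_sub, neg_add_cancel, zero_sub, neg_mul, padicNorm.neg,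
      mul_comm]
    simpa using padicNorm_mul_prime_pow_lt_one hnorm one_ne_zero
  · convert pcong.refl _ using 1
    field_simp

theorem pcong_one_div_sub {k : ℕ} (hk : k ∈ Icc 1 (p - 1)) :
    pcong p (1 / ((p - k : ℕ) : ℚ)) (-1 / (k : ℚ)) := by
  obtain ⟨hk1, hkp⟩ := mem_Icc.mp hk
  have hlt : 0 < p - k := by omega
  have hk0 : (k : ℚ) ≠ 0 := by positivity
  have hk0' : ((p - k : ℕ) : ℚ) ≠ 0 := by positivity
  have h : 1 / ((p - k : ℕ) : ℚ) - -1 / (k : ℚ) = p / (((p - k : ℕ) : ℚ) * k) := by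
    rw [div_sub_div _ _ hk0' hk0, Nat.cast_sub (by omega)]
    ring
  rw [pcong_iff, h, padicNorm.div, padicNorm.mul, padicNorm_natCast_eq_one hk1 (by omega),
    padicNorm_natCast_eq_one hlt (by omega), mul_one, div_one]
  exact padicNorm.padicNorm_p_lt_one_of_prime

theorem pcong_pow_div_pow_sub (hp : Odd p) {c : ℚ} (hc : c = 1 ∨ c = -1) (a : ℕ) {k : ℕ}
    (hk : k ∈ Icc 1 (p - 1)) :
    pcong p (c ^ (p - k) / ((p - k : ℕ) : ℚ) ^ a) (c * (-1) ^ a * (c ^ k / (k : ℚ) ^ a)) := by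
  have hk' : p - k ∈ Icc 1 (p - 1) := by rw [mem_Icc] at hk ⊢; omega
  have hle : k ≤ p := by have := mem_Icc.mp hk; omega
  have hpow : c ^ (p - k) = c ^ (k + 1) := by
    rcases hc with rfl | rfl
    · simp
    · rcases Nat.even_or_odd k with h | h
      · rw [(Nat.Odd.sub_even hle hp h).neg_one_pow, h.add_one.neg_one_pow]
      · rw [(Nat.Odd.sub_odd hp h).neg_one_pow, h.add_one.neg_one_pow]
  have hc' : padicNorm p (c ^ (k + 1)) ≤ 1 := by
    rcases hc with rfl | rfl <;> simp
  have h1 := padicNorm_pow_div_pow_le_one (p := p) (Or.inl rfl) 1 hk'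
  have h2 := padicNorm_pow_div_pow_le_one (p := p) (Or.inl rfl) 1 hk
  rw [one_pow, pow_one] at h1 h2
  have := ((pcong_one_div_sub hk).pow h1 (by rwa [neg_div, padicNorm.neg]) a).mul_left hc'
  rw [hpow]
  convert this using 1
  · rw [div_pow, one_pow]; ring
  · rw [div_pow]; ring

theorem pcong_double_sum_comm (hp : Odd p) {c : ℚ} (hc : c = 1 ∨ c = -1) {a b : ℕ}
    (hab : Even (a + b)) :
    pcong p (∑ k ∈ Icc 1 (p - 1), c ^ k / (k : ℚ) ^ b * ∑ j ∈ Icc 1 (k - 1), c ^ j / (j : ℚ) ^ a)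
      (∑ k ∈ Icc 1 (p - 1), c ^ k / (k : ℚ) ^ a * ∑ j ∈ Icc 1 (k - 1), c ^ j / (j : ℚ) ^ b) := by
  have hp1 : p - 1 + 1 = p := Nat.sub_add_cancel hp.pos
  rw [sum_mul_sum_Icc_reflect (fun k => c ^ k / (k : ℚ) ^ a) (fun k => c ^ k / (k : ℚ) ^ b)]
  simp only [hp1, mul_sum]
  refine pcong.sum fun k hk => pcong.sum fun j hj => ?_
  have hj : j ∈ Icc 1 (p - 1) := by rw [mem_Icc] at hk hj ⊢; omega
  have hk' : p - k ∈ Icc 1 (p - 1) := by rw [mem_Icc] at hk ⊢; omega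
  have hcb : padicNorm p (c * (-1) ^ b) ≤ 1 := by
    rcases hc with rfl | rfl <;> simp
  have := (pcong_pow_div_pow_sub hp hc a hk).mul (padicNorm_pow_div_pow_le_one hc a hk')
    (padicNorm_mul_le_one hcb (padicNorm_pow_div_pow_le_one hc b hj))
    (pcong_pow_div_pow_sub hp hc b hj)
  convert this using 1
  have h1 : c * c = 1 := by rcases hc with rfl | rfl <;> norm_num
  have h2 : (-1 : ℚ) ^ a * (-1) ^ b = 1 := by rw [← pow_add, hab.neg_one_pow]
  linear_combination (-(c ^ k / (k : ℚ) ^ a * (c ^ j / (j : ℚ) ^ b))) *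
    ((-1) ^ a * (-1) ^ b * h1 + h2)

theorem sum_pow_div_pow_mul {c : ℚ} (hc : c = 1 ∨ c = -1) (a b n : ℕ) :
    ∑ k ∈ Icc 1 n, c ^ k / (k : ℚ) ^ a * (c ^ k / (k : ℚ) ^ b) =
      ∑ k ∈ Icc 1 n, (1 : ℚ) ^ k / (k : ℚ) ^ (a + b) := by
  refine sum_congr rfl fun k _ => ?_
  rw [div_mul_div_comm, ← mul_pow, ← pow_add]
  rcases hc with rfl | rfl <;> norm_num

theorem pcong_two_mul_double_sum (hp : Odd p) {c : ℚ} (hc : c = 1 ∨ c = -1) {a b : ℕ} (ha : 0 < a)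
    (hab : Even (a + b)) (hpw : a + b + 1 < p) :
    pcong p
      (2 * ∑ k ∈ Icc 1 (p - 1), c ^ k / (k : ℚ) ^ b * ∑ j ∈ Icc 1 (k - 1), c ^ j / (j : ℚ) ^ a)
      ((∑ k ∈ Icc 1 (p - 1), c ^ k / (k : ℚ) ^ a) * ∑ k ∈ Icc 1 (p - 1), c ^ k / (k : ℚ) ^ b) := by
  rw [sum_mul_sum_Icc_eq, sum_pow_div_pow_mul hc, two_mul]
  rw [← add_zero (_ + _ : ℚ)]
  exact ((pcong.refl _).add (pcong_double_sum_comm hp hc hab)).add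
    (pcong_sum_one_div_pow (by omega) hpw).symm

end Congruence

theorem H_pair (s t : ℤ) (n : ℕ) :
    H [s, t] n = ∑ k ∈ Icc 1 n, sgn t ^ k / (k : ℚ) ^ t.natAbs *
      ∑ j ∈ Icc 1 (k - 1), sgn s ^ j / (j : ℚ) ^ s.natAbs := by
  simp [H, Hrev]

theorem S_pair (s t : ℤ) (n : ℕ) :
    S [s, t] n = H [s, t] n + ∑ k ∈ Icc 1 n, sgn s ^ k / (k : ℚ) ^ s.natAbs *
      (sgn t ^ k / (k : ℚ) ^ t.natAbs) := by
  rw [H_pair, ← sum_add_distrib]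
  simp only [S, Srev, List.reverse_cons, List.reverse_nil, List.nil_append, List.cons_append,
    mul_one]
  refine sum_congr rfl fun k hk => ?_
  obtain ⟨m, rfl⟩ := Nat.exists_eq_succ_of_ne_zero (Nat.one_le_iff_ne_zero.mp (mem_Icc.mp hk).1)
  rw [Nat.succ_eq_add_one, sum_Icc_succ_top (Nat.le_add_left 1 m), Nat.add_sub_cancel]
  ring

/-- Depth two AMHS of even weight: the two cases with compact formulae. -/
theorem depth_two_even_weight (a b : ℕ) (ha : 0 < a) (hb : 0 < b) (hab : Even (a + b))
    (p : ℕ) (hp : p.Prime) (hpw : a + b + 2 ≤ p) :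
    pcong p (S [(a : ℤ), (b : ℤ)] (p - 1)) 0 ∧
    pcong p (H [(a : ℤ), (b : ℤ)] (p - 1)) 0 ∧
    pcong p (S [-(a : ℤ), -(b : ℤ)] (p - 1)) (H [-(a : ℤ), -(b : ℤ)] (p - 1)) ∧
    pcong p (H [-(a : ℤ), -(b : ℤ)] (p - 1))
      (2 * (1 - 2 ^ (p - a)) * (1 - 2 ^ (p - b)) / ((a : ℚ) * b) *
        bernoulli (p - a) * bernoulli (p - b)) := by
  have : Fact p.Prime := ⟨hp⟩
  have hodd : Odd p := hp.odd_of_ne_two (by omega)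
  have sgn_natCast (n : ℕ) : sgn n = 1 := by simp [sgn]
  have sgn_neg {n : ℕ} (hn : 0 < n) : sgn (-(n : ℤ)) = -1 := by simp [sgn, hn]
  have norm_two : padicNorm p 2 = 1 := by
    exact_mod_cast padicNorm_natCast_eq_one (p := p) two_pos (by omega)
  have hS {c : ℚ} (hc : c = 1 ∨ c = -1) : pcong p
      (∑ k ∈ Icc 1 (p - 1), c ^ k / (k : ℚ) ^ a * (c ^ k / (k : ℚ) ^ b)) 0 := by
    rw [sum_pow_div_pow_mul hc]
    exact pcong_sum_one_div_pow (by omega) (by omega)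
  have norm_sum {c : ℚ} (hc : c = 1 ∨ c = -1) (n : ℕ) :
      padicNorm p (∑ k ∈ Icc 1 (p - 1), c ^ k / (k : ℚ) ^ n) ≤ 1 :=
    padicNorm.sum_le' (fun k hk => padicNorm_pow_div_pow_le_one hc n hk) zero_le_one
  have hH : pcong p (H [(a : ℤ), (b : ℤ)] (p - 1)) 0 := by
    simp only [H_pair, sgn_natCast, Int.natAbs_natCast]
    refine pcong.of_mul_left norm_two
      ((pcong_two_mul_double_sum hodd (Or.inl rfl) ha hab hpw).trans ?_)
    simpa using (pcong_sum_one_div_pow (p := p) hb (by omega)).mul_left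
      (norm_sum (Or.inl rfl) a)
  refine ⟨?_, hH, ?_, ?_⟩
  · rw [S_pair]
    simpa [sgn_natCast] using hH.add (hS (Or.inl rfl))
  · rw [S_pair]
    simpa [sgn_neg ha, sgn_neg hb] using (pcong.refl _).add (hS (Or.inr rfl))
  · simp only [H_pair, sgn_neg ha, sgn_neg hb, Int.natAbs_neg, Int.natAbs_natCast]
    have hA := pcong_alternating_sum_one_div_pow hodd ha (by omega)
    have hB := pcong_alternating_sum_one_div_pow hodd hb (by omega)
    have hBnorm : padicNorm p (-(2 * (1 - 2 ^ (p - b)) * bernoulli (p - b) / b)) ≤ 1 := by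
      have := padicNorm.sub.trans (max_le (norm_sum (Or.inr rfl) b) (pcong_iff.mp hB).le)
      rwa [sub_sub_cancel] at this
    refine pcong.of_mul_left norm_two
      ((pcong_two_mul_double_sum hodd (Or.inr rfl) ha hab hpw).trans ?_)
    convert hA.mul (norm_sum (Or.inr rfl) a) hBnorm hB using 1
    field_simp
end

section
/- Let a,b be positive integers with a+b even and let p be a prime with p \ge a+b+2. Writing H(-)=H(-;p-1) and S(-)=S(-;p-1), one has S(-a,b) \equiv H(-a,b) \equiv -S(b,-a) \equiv -H(b,-a) \equiv \sum_{k=1}^{p-2-a-b} \binom{p-1-a}{k} \frac{2(1-2^{k+1})(1-2^{p-a-b-k}) B_{k+1} B_{p-a-b-k}}{(k+1)(a+b+k)} + \sum_{k=p-1-a-b}^{p-1-a} \binom{p-1-a}{k} \frac{2(1-2^{k+1})(1-2^{2p-1-a-b-k}) B_{k+1} B_{2p-1-a-b-k}}{(k+1)(1+a+b+k)} \pmod{p}. -/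
open Finset

/-- The value at `0` of the `n`-th Euler polynomial, in terms of Bernoulli numbers. -/
def eulerZero (n : ℕ) : ℚ := 2 * (1 - 2 ^ (n + 1)) * bernoulli (n + 1) / (n + 1)

lemma eulerZero_eq_zero_of_even {n : ℕ} (hn : Even n) (hn0 : n ≠ 0) : eulerZero n = 0 := by
  rw [eulerZero, bernoulli_eq_zero_of_odd hn.add_one (by lia)]
  simp

section PowerSeries

open PowerSeries

lemma X_mul_mk_eulerZero :
    X * PowerSeries.mk (fun n => eulerZero n / n.factorial) =
      2 * (bernoulliPowerSeries ℚ - rescale 2 (bernoulliPowerSeries ℚ)) := by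
  have h2 : (2 : PowerSeries ℚ) = C 2 := (map_ofNat C 2).symm
  ext n
  rw [h2, coeff_C_mul]
  cases n with
  | zero =>
    simp only [coeff_zero_X_mul, map_sub, coeff_rescale, pow_zero, one_mul, sub_self, mul_zero]
  | succ n =>
    simp only [coeff_succ_X_mul, coeff_mk, map_sub, coeff_rescale, bernoulliPowerSeries,
      eulerZero, Nat.factorial_succ, Algebra.algebraMap_self, RingHom.id_apply]
    have : (n.factorial : ℚ) ≠ 0 := by exact_mod_cast n.factorial_ne_zero
    have : (n + 1 : ℚ) ≠ 0 := by positivity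
    push_cast
    field_simp

lemma mk_eulerZero_mul_exp_add_one :
    PowerSeries.mk (fun n => eulerZero n / n.factorial) * (exp ℚ + 1) = 2 := by
  set G := PowerSeries.mk (fun n => eulerZero n / n.factorial) with hG
  set B := bernoulliPowerSeries ℚ
  have hE1 : exp ℚ - 1 ≠ 0 := by
    intro h
    simpa using congrArg (coeff 1) h
  have hB : B * (exp ℚ - 1) = X := bernoulliPowerSeries_mul_exp_sub_one ℚ
  have hB2 : rescale 2 B * (exp ℚ ^ 2 - 1) = 2 * X := by
    have h := congrArg (rescale (2 : ℚ)) hB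
    have h2 : (2 : PowerSeries ℚ) = C 2 := (map_ofNat C 2).symm
    rw [map_mul, map_sub, map_one, rescale_X, ← h2] at h
    rw [exp_pow_eq_rescale_exp]
    exact_mod_cast h
  have hX : X * G = 2 * (B - rescale 2 B) := X_mul_mk_eulerZero
  apply mul_left_cancel₀ (mul_ne_zero hE1 (X_ne_zero (R := ℚ)))
  linear_combination (exp ℚ - 1) * (exp ℚ + 1) * hX + 2 * (exp ℚ + 1) * hB - 2 * hB2

lemma two_mul_sum_neg_exp_pow (n : ℕ) :
    2 * ∑ j ∈ range n, (-exp ℚ) ^ j =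
      PowerSeries.mk (fun n => eulerZero n / n.factorial) * (1 - (-exp ℚ) ^ n) := by
  rw [← mul_neg_geom_sum, ← mk_eulerZero_mul_exp_add_one]
  ring

lemma coeff_neg_exp_pow (j d : ℕ) :
    coeff d ((-exp ℚ) ^ j) = (-1) ^ j * ((j : ℚ) ^ d / d.factorial) := by
  have h : ((-1 : PowerSeries ℚ)) ^ j = C ((-1 : ℚ) ^ j) := by simp
  rw [neg_pow, h, coeff_C_mul, exp_pow_eq_rescale_exp, coeff_rescale, coeff_exp]
  simp [div_eq_mul_inv]

/-- Alternating power sums as values of Euler polynomials. -/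
theorem two_mul_sum_neg_one_pow_mul_pow (n d : ℕ) :
    2 * ∑ j ∈ range n, (-1 : ℚ) ^ j * (j : ℚ) ^ d =
      eulerZero d -
        (-1) ^ n * ∑ k ∈ range (d + 1), (d.choose k : ℚ) * eulerZero k * (n : ℚ) ^ (d - k) := by
  have hd : (d.factorial : ℚ) ≠ 0 := by exact_mod_cast d.factorial_ne_zero
  have h2 : (2 : PowerSeries ℚ) = C 2 := (map_ofNat C 2).symm
  have h := congrArg (coeff d) (two_mul_sum_neg_exp_pow n)
  rw [h2, coeff_C_mul, map_sum, mul_sub, mul_one, map_sub, coeff_mk, coeff_mul,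
    Finset.Nat.sum_antidiagonal_eq_sum_range_succ_mk] at h
  simp only [coeff_neg_exp_pow, coeff_mk] at h
  have h' := congrArg (fun x => (d.factorial : ℚ) * x) h
  simp only [mul_sub, Finset.mul_sum] at h' ⊢
  convert h' using 1
  · refine Finset.sum_congr rfl fun j _ => ?_
    field_simp
  · congr 1
    · field_simp
    · refine Finset.sum_congr rfl fun k hk => ?_
      have hk : k ≤ d := Nat.lt_succ_iff.mp (Finset.mem_range.mp hk)
      have hkf : (k.factorial : ℚ) ≠ 0 := by exact_mod_cast k.factorial_ne_zero
      have hdf : ((d - k).factorial : ℚ) ≠ 0 := by exact_mod_cast (d - k).factorial_ne_zero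
      rw [Nat.cast_choose ℚ hk]
      field_simp

end PowerSeries

/-- `x` is `p`-integral and its residue modulo `p` is `z`. -/
def ReducesTo (p : ℕ) [Fact p.Prime] (x : ℚ) (z : ZMod p) : Prop :=
  (x.den : ZMod p) ≠ 0 ∧ (x : ZMod p) = z

namespace ReducesTo

variable {p : ℕ} [Fact p.Prime] {x y : ℚ} {z w : ZMod p}

lemma add (hx : ReducesTo p x z) (hy : ReducesTo p y w) : ReducesTo p (x + y) (z + w) := by
  refine ⟨fun h => ?_, by rw [Rat.cast_add_of_ne_zero hx.1 hy.1, hx.2, hy.2]⟩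
  have hd : ((x.den * y.den : ℕ) : ZMod p) = 0 := by
    obtain ⟨c, hc⟩ := Rat.add_den_dvd x y
    rw [hc, Nat.cast_mul, h, zero_mul]
  rw [Nat.cast_mul] at hd
  exact mul_ne_zero hx.1 hy.1 hd

lemma mul (hx : ReducesTo p x z) (hy : ReducesTo p y w) : ReducesTo p (x * y) (z * w) := by
  refine ⟨fun h => ?_, by rw [Rat.cast_mul_of_ne_zero hx.1 hy.1, hx.2, hy.2]⟩
  have hd : ((x.den * y.den : ℕ) : ZMod p) = 0 := by
    obtain ⟨c, hc⟩ := Rat.mul_den_dvd x y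
    rw [hc, Nat.cast_mul, h, zero_mul]
  rw [Nat.cast_mul] at hd
  exact mul_ne_zero hx.1 hy.1 hd

lemma neg (hx : ReducesTo p x z) : ReducesTo p (-x) (-z) :=
  ⟨by simpa using hx.1, by rw [Rat.cast_neg, hx.2]⟩

lemma sub (hx : ReducesTo p x z) (hy : ReducesTo p y w) : ReducesTo p (x - y) (z - w) := by
  simpa [sub_eq_add_neg] using hx.add hy.neg

lemma natCast (n : ℕ) : ReducesTo p (n : ℚ) (n : ZMod p) := ⟨by simp, by simp⟩

lemma inv_natCast {n : ℕ} (hn : (n : ZMod p) ≠ 0) : ReducesTo p ((n : ℚ)⁻¹) (n : ZMod p)⁻¹ := by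
  have h0 : 0 < n := Nat.pos_of_ne_zero fun h => hn (by simp [h])
  refine ⟨by rwa [Rat.inv_natCast_den_of_pos h0], ?_⟩
  rw [Rat.cast_inv_of_ne_zero (by simpa using hn), Rat.cast_natCast]

lemma pow (hx : ReducesTo p x z) (n : ℕ) : ReducesTo p (x ^ n) (z ^ n) := by
  induction n with
  | zero => simpa using natCast (p := p) 1
  | succ n ih => simpa only [pow_succ] using ih.mul hx

lemma sum {ι : Type*} {s : Finset ι} {f : ι → ℚ} {g : ι → ZMod p}
    (h : ∀ i ∈ s, ReducesTo p (f i) (g i)) : ReducesTo p (∑ i ∈ s, f i) (∑ i ∈ s, g i) := by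
  classical
  induction s using Finset.induction_on with
  | empty => simpa using natCast (p := p) 0
  | insert i s hi ih =>
    rw [Finset.sum_insert hi, Finset.sum_insert hi]
    exact (h i (Finset.mem_insert_self i s)).add
      (ih fun j hj => h j (Finset.mem_insert_of_mem hj))

lemma eq (hx : ReducesTo p x z) (hy : ReducesTo p x w) : z = w := hx.2.symm.trans hy.2

lemma pcong (hx : ReducesTo p x z) (hy : ReducesTo p y z) : pcong p x y := by
  have h := hx.sub hy
  rw [sub_self] at h
  have h0 := h.2
  rw [Rat.cast_def, div_eq_zero_iff, or_iff_left h.1] at h0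
  exact (ZMod.intCast_zmod_eq_zero_iff_dvd _ _).mp h0

end ReducesTo

section Residues

variable {p : ℕ} [Fact p.Prime]

lemma ZMod.two_ne_zero_of_odd (hp : Odd p) : (2 : ZMod p) ≠ 0 :=
  Ring.two_ne_zero (by
    rw [ZMod.ringChar_zmod_n]
    rintro rfl
    exact absurd hp (by decide))

lemma reducesTo_inv_two (hp2 : (2 : ZMod p) ≠ 0) : ReducesTo p (2⁻¹ : ℚ) (2⁻¹ : ZMod p) := by
  simpa using ReducesTo.inv_natCast (p := p) (n := 2) hp2

lemma reducesTo_neg_one_pow (n : ℕ) : ReducesTo p ((-1 : ℚ) ^ n) ((-1 : ZMod p) ^ n) := by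
  simpa using ((ReducesTo.natCast (p := p) 1).neg).pow n

lemma exists_reducesTo_eulerZero (hp2 : (2 : ZMod p) ≠ 0) (d : ℕ) :
    ∃ z, ReducesTo p (eulerZero d) z := by
  induction d using Nat.strong_induction_on with
  | _ d ih =>
    choose! g hg using ih
    have h := two_mul_sum_neg_one_pow_mul_pow 1 d
    have hpow : ∑ j ∈ range 1, (-1 : ℚ) ^ j * (j : ℚ) ^ d = ((0 ^ d : ℕ) : ℚ) := by simp
    rw [hpow, Finset.sum_range_succ] at h
    have he : eulerZero d = ((0 ^ d : ℕ) : ℚ) -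
        2⁻¹ * ∑ k ∈ range d, (d.choose k : ℚ) * eulerZero k := by
      simp only [Nat.cast_one, one_pow, mul_one, Nat.choose_self] at h
      linarith
    rw [he]
    exact ⟨_, (ReducesTo.natCast _).sub ((reducesTo_inv_two hp2).mul
      (ReducesTo.sum fun k hk => (ReducesTo.natCast _).mul (hg k (Finset.mem_range.mp hk))))⟩

lemma reducesTo_eulerZero (hp2 : (2 : ZMod p) ≠ 0) (d : ℕ) :
    ReducesTo p (eulerZero d) (eulerZero d : ZMod p) := by
  obtain ⟨z, hz⟩ := exists_reducesTo_eulerZero hp2 d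
  exact ⟨hz.1, rfl⟩

lemma two_mul_sum_neg_one_pow_mul_pow_zmod (hp2 : (2 : ZMod p) ≠ 0) (n d : ℕ) :
    2 * ∑ j ∈ range n, (-1 : ZMod p) ^ j * (j : ZMod p) ^ d =
      (eulerZero d : ZMod p) - (-1) ^ n * ∑ k ∈ range (d + 1),
        (d.choose k : ZMod p) * (eulerZero k : ZMod p) * (n : ZMod p) ^ (d - k) := by
  have hl : ReducesTo p (2 * ∑ j ∈ range n, (-1 : ℚ) ^ j * (j : ℚ) ^ d) _ :=
    (ReducesTo.natCast 2).mul (ReducesTo.sum fun j _ =>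
      (reducesTo_neg_one_pow j).mul ((ReducesTo.natCast j).pow d))
  rw [two_mul_sum_neg_one_pow_mul_pow] at hl
  have hr := (reducesTo_eulerZero hp2 d).sub ((reducesTo_neg_one_pow n).mul
    (ReducesTo.sum (s := range (d + 1)) fun k _ => ((ReducesTo.natCast (d.choose k)).mul
      (reducesTo_eulerZero hp2 k)).mul ((ReducesTo.natCast (p := p) n).pow (d - k))))
  exact_mod_cast hl.eq hr

lemma sum_range_prime_neg_one_pow_mul_pow (hp : Odd p) (d : ℕ) :
    ∑ j ∈ range p, (-1 : ZMod p) ^ j * (j : ZMod p) ^ d = (eulerZero d : ZMod p) := by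
  have hp2 := ZMod.two_ne_zero_of_odd hp
  apply mul_left_cancel₀ hp2
  rw [two_mul_sum_neg_one_pow_mul_pow_zmod hp2, Finset.sum_range_succ, Finset.sum_eq_zero]
  · simp [hp.neg_one_pow]
    ring
  · intro k hk
    have : d - k ≠ 0 := by have := Finset.mem_range.mp hk; lia
    simp [this]

lemma sum_range_prime_pow {i : ℕ} (hi : i < p - 1) :
    ∑ j ∈ range p, (j : ZMod p) ^ i = 0 := by
  rw [← FiniteField.sum_pow_lt_card_sub_one (ZMod p) i (by rwa [ZMod.card])]
  refine Finset.sum_bij (fun j _ => (j : ZMod p)) (by simp) ?_ ?_ (by simp)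
  · intro i hi j hj h
    rw [ZMod.natCast_eq_natCast_iff'] at h
    rwa [Nat.mod_eq_of_lt (by simpa using hi), Nat.mod_eq_of_lt (by simpa using hj)] at h
  · intro x _
    exact ⟨x.val, by simpa using x.val_lt, by simp⟩

lemma ZMod.pow_add_card_sub_one {r : ℕ} (hr : r ≠ 0) (x : ZMod p) : x ^ (r + (p - 1)) = x ^ r := by
  rcases eq_or_ne x 0 with rfl | hx
  · simp [hr]
  · rw [pow_add, ZMod.pow_card_sub_one_eq_one hx, mul_one]

/-- Kummer's congruence for the values of Euler polynomials at `0`. -/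
lemma eulerZero_add_card_sub_one (hp : Odd p) {r : ℕ} (hr : r ≠ 0) :
    (eulerZero (r + (p - 1)) : ZMod p) = (eulerZero r : ZMod p) := by
  simp only [← sum_range_prime_neg_one_pow_mul_pow hp, ZMod.pow_add_card_sub_one hr]

lemma ZMod.inv_pow_eq_pow_card_sub_one_sub {s : ℕ} (hs : s ≤ p - 1) {x : ZMod p} (hx : x ≠ 0) :
    (x ^ s)⁻¹ = x ^ (p - 1 - s) := by
  apply inv_eq_of_mul_eq_one_right
  rw [← pow_add, Nat.add_sub_cancel' hs, ZMod.pow_card_sub_one_eq_one hx]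

lemma ZMod.natCast_ne_zero_of_mem_Icc {k : ℕ} (hk : k ∈ Finset.Icc 1 (p - 1)) :
    (k : ZMod p) ≠ 0 := by
  rw [Finset.mem_Icc] at hk
  rw [Ne, ZMod.natCast_eq_zero_iff]
  exact Nat.not_dvd_of_pos_of_lt (by lia) (by lia)

lemma reducesTo_pow_div_pow {u : ℚ} {v : ZMod p} (huv : ReducesTo p u v) {s : ℕ}
    (hs : s ≤ p - 1) {k : ℕ} (hk : k ∈ Finset.Icc 1 (p - 1)) :
    ReducesTo p (u ^ k / (k : ℚ) ^ s) (v ^ k * (k : ZMod p) ^ (p - 1 - s)) := by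
  have hk0 := ZMod.natCast_ne_zero_of_mem_Icc hk
  rw [← ZMod.inv_pow_eq_pow_card_sub_one_sub hs hk0, div_eq_mul_inv, ← inv_pow, ← inv_pow]
  exact (huv.pow k).mul ((ReducesTo.inv_natCast hk0).pow s)

lemma sum_Icc_one_eq_sum_range {M : Type*} [AddCommMonoid M] {f : ℕ → M} (hf : f 0 = 0) (n : ℕ) :
    ∑ k ∈ Finset.Icc 1 n, f k = ∑ k ∈ range (n + 1), f k := by
  refine Finset.sum_subset (fun k hk => ?_) fun k hk hk' => ?_
  · simp only [Finset.mem_Icc, Finset.mem_range] at *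
    lia
  · obtain rfl : k = 0 := by
      simp only [Finset.mem_Icc, Finset.mem_range] at *
      lia
    exact hf

lemma reducesTo_H_pair {s t : ℤ} {f g : ℕ → ZMod p}
    (hf : ∀ k ∈ Finset.Icc 1 (p - 1), ReducesTo p (sgn s ^ k / (k : ℚ) ^ s.natAbs) (f k))
    (hg : ∀ k ∈ Finset.Icc 1 (p - 1), ReducesTo p (sgn t ^ k / (k : ℚ) ^ t.natAbs) (g k))
    (hf0 : f 0 = 0) :
    ReducesTo p (H [s, t] (p - 1)) (∑ k ∈ range p, g k * ∑ j ∈ range k, f j) := by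
  have hp1 : p - 1 + 1 = p := Nat.sub_add_cancel (Fact.out : p.Prime).one_le
  have h := sum_Icc_one_eq_sum_range (f := fun k => g k * ∑ j ∈ range k, f j) (by simp) (p - 1)
  rw [hp1] at h
  rw [← h]
  simp only [H, List.reverse_cons, List.reverse_nil, List.nil_append, List.cons_append, Hrev,
    mul_one]
  refine ReducesTo.sum fun k hk => (hg k hk).mul ?_
  have hk' := Finset.mem_Icc.mp hk
  have hk1 : k - 1 + 1 = k := by lia
  have h := sum_Icc_one_eq_sum_range hf0 (k - 1)
  rw [hk1] at h
  rw [← h]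
  refine ReducesTo.sum fun j hj => hf j ?_
  simp only [Finset.mem_Icc] at *
  lia

lemma reducesTo_S_pair {s t : ℤ} {f g : ℕ → ZMod p}
    (hf : ∀ k ∈ Finset.Icc 1 (p - 1), ReducesTo p (sgn s ^ k / (k : ℚ) ^ s.natAbs) (f k))
    (hg : ∀ k ∈ Finset.Icc 1 (p - 1), ReducesTo p (sgn t ^ k / (k : ℚ) ^ t.natAbs) (g k))
    (hf0 : f 0 = 0) (hg0 : g 0 = 0) :
    ReducesTo p (S [s, t] (p - 1)) (∑ k ∈ range p, g k * ∑ j ∈ range (k + 1), f j) := by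
  have hp1 : p - 1 + 1 = p := Nat.sub_add_cancel (Fact.out : p.Prime).one_le
  have h := sum_Icc_one_eq_sum_range (f := fun k => g k * ∑ j ∈ range (k + 1), f j)
    (by simp [hg0]) (p - 1)
  rw [hp1] at h
  rw [← h]
  simp only [S, List.reverse_cons, List.reverse_nil, List.nil_append, List.cons_append, Srev,
    mul_one]
  refine ReducesTo.sum fun k hk => (hg k hk).mul ?_
  rw [← sum_Icc_one_eq_sum_range hf0 k]
  refine ReducesTo.sum fun j hj => hf j ?_
  simp only [Finset.mem_Icc] at *
  lia

lemma sum_mul_sum_range_add_sum_mul_sum_range_succ {R : Type*} [CommRing R] (f g : ℕ → R) (n : ℕ) :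
    ∑ k ∈ range n, g k * ∑ j ∈ range k, f j + ∑ k ∈ range n, f k * ∑ j ∈ range (k + 1), g j =
      (∑ k ∈ range n, f k) * ∑ k ∈ range n, g k := by
  induction n with
  | zero => simp
  | succ n ih =>
    simp only [Finset.sum_range_succ _ n]
    linear_combination ih

lemma sum_mul_sum_range_succ {R : Type*} [CommRing R] (f g : ℕ → R) (n : ℕ) :
    ∑ k ∈ range n, g k * ∑ j ∈ range (k + 1), f j =
      ∑ k ∈ range n, g k * ∑ j ∈ range k, f j + ∑ k ∈ range n, g k * f k := by
  simp only [Finset.sum_range_succ _ (_ : ℕ), mul_add, Finset.sum_add_distrib]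

lemma sum_pow_mul_sum_neg_one_pow_mul_pow (hp : Odd p) {c : ℕ} (hc : c < p - 1) (d : ℕ) :
    ∑ n ∈ range p, (n : ZMod p) ^ c * ∑ j ∈ range n, (-1) ^ j * (j : ZMod p) ^ d =
      ∑ k ∈ range (d + 1), (d.choose k : ZMod p) *
        (-2⁻¹ * eulerZero k * eulerZero (c + (d - k))) := by
  have hp2 := ZMod.two_ne_zero_of_odd hp
  apply mul_left_cancel₀ hp2
  simp only [Finset.mul_sum (range p), mul_left_comm (2 : ZMod p),
    two_mul_sum_neg_one_pow_mul_pow_zmod hp2, mul_sub, Finset.sum_sub_distrib,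
    ← Finset.sum_mul, sum_range_prime_pow hc, zero_mul, zero_sub,
    ← sum_range_prime_neg_one_pow_mul_pow hp (c + _)]
  simp only [Finset.mul_sum, ← Finset.sum_neg_distrib]
  rw [Finset.sum_comm]
  refine Finset.sum_congr rfl fun k _ => Finset.sum_congr rfl fun n _ => ?_
  field_simp
  ring

lemma reducesTo_bernoulli_mul_bernoulli_div (hp : Odd p) (k r : ℕ) {N : ℕ}
    (hN : (N : ZMod p) ≠ 0) (hrN : ((r + 1 + N : ℕ) : ZMod p) = 0) :
    ReducesTo p (2 * (1 - 2 ^ (k + 1)) * (1 - 2 ^ (r + 1)) * bernoulli (k + 1) *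
      bernoulli (r + 1) / (((k : ℚ) + 1) * N)) (-2⁻¹ * eulerZero k * eulerZero r) := by
  have hp2 := ZMod.two_ne_zero_of_odd hp
  have hN0 : (N : ℚ) ≠ 0 := by
    rw [Nat.cast_ne_zero]
    rintro rfl
    simp at hN
  have h := ((reducesTo_inv_two hp2).mul (reducesTo_eulerZero hp2 k)).mul
    ((reducesTo_eulerZero hp2 r).mul ((ReducesTo.natCast (r + 1)).mul (ReducesTo.inv_natCast hN)))
  convert h using 1
  · have hk : (k + 1 : ℚ) ≠ 0 := by positivity
    have hr : (r + 1 : ℚ) ≠ 0 := by positivity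
    rw [eulerZero, eulerZero]
    push_cast
    field_simp
  · have hr : ((r + 1 : ℕ) : ZMod p) = -N := by
      rw [Nat.cast_add] at hrN
      exact eq_neg_of_add_eq_zero_left hrN
    rw [hr]
    field_simp

end Residues

/-- Even weight, depth two: congruence for `H(-a,b)` via a Bernoulli-number sum. -/
theorem depth_two_even_weight_mixed' (a b : ℕ) (ha : 0 < a) (hb : 0 < b)
    (hab : Even (a + b)) (p : ℕ) (hp : p.Prime) (hpw : a + b + 2 ≤ p) :
    pcong p (S [-(a : ℤ), (b : ℤ)] (p - 1)) (H [-(a : ℤ), (b : ℤ)] (p - 1)) ∧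
    pcong p (H [-(a : ℤ), (b : ℤ)] (p - 1)) (-S [(b : ℤ), -(a : ℤ)] (p - 1)) ∧
    pcong p (-S [(b : ℤ), -(a : ℤ)] (p - 1)) (-H [(b : ℤ), -(a : ℤ)] (p - 1)) ∧
    pcong p (-H [(b : ℤ), -(a : ℤ)] (p - 1))
      ((∑ k ∈ Finset.Icc 1 (p - 2 - a - b),
          (Nat.choose (p - 1 - a) k : ℚ) *
            (2 * (1 - 2 ^ (k + 1)) * (1 - 2 ^ (p - a - b - k)) * bernoulli (k + 1) *
                bernoulli (p - a - b - k) /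
              (((k : ℚ) + 1) * ((a : ℚ) + b + k)))) +
        ∑ k ∈ Finset.Icc (p - 1 - a - b) (p - 1 - a),
          (Nat.choose (p - 1 - a) k : ℚ) *
            (2 * (1 - 2 ^ (k + 1)) * (1 - 2 ^ (2 * p - 1 - a - b - k)) * bernoulli (k + 1) *
                bernoulli (2 * p - 1 - a - b - k) /
              (((k : ℚ) + 1) * (1 + (a : ℚ) + b + k)))) := by
  have : Fact p.Prime := ⟨hp⟩
  have hodd : Odd p := hp.odd_of_ne_two (by lia)
  set A : ℕ → ZMod p := fun k => (-1) ^ k * (k : ZMod p) ^ (p - 1 - a) with hA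
  set B : ℕ → ZMod p := fun k => (k : ZMod p) ^ (p - 1 - b) with hB
  have hA0 : A 0 = 0 := by simp [hA, show p - 1 - a ≠ 0 by lia]
  have hB0 : B 0 = 0 := by simp [hB, show p - 1 - b ≠ 0 by lia]
  have hAr : ∀ k ∈ Finset.Icc 1 (p - 1),
      ReducesTo p (sgn (-(a : ℤ)) ^ k / (k : ℚ) ^ (-(a : ℤ)).natAbs) (A k) := fun k hk => by
    have hs : sgn (-(a : ℤ)) = -1 := if_pos (by lia)
    rw [hs, Int.natAbs_neg, Int.natAbs_natCast]
    exact reducesTo_pow_div_pow (by simpa using (ReducesTo.natCast (p := p) 1).neg) (by lia) hk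
  have hBr : ∀ k ∈ Finset.Icc 1 (p - 1),
      ReducesTo p (sgn (b : ℤ) ^ k / (k : ℚ) ^ (b : ℤ).natAbs) (B k) := fun k hk => by
    have hs : sgn (b : ℤ) = 1 := if_neg (by lia)
    rw [hs, Int.natAbs_natCast]
    have h := reducesTo_pow_div_pow (p := p) (u := 1) (v := 1) (s := b)
      (by simpa using ReducesTo.natCast (p := p) 1) (by lia) hk
    rwa [one_pow (M := ZMod p), one_mul] at h
  have hBsum : ∑ k ∈ range p, B k = 0 := sum_range_prime_pow (by lia)
  have hABsum : ∑ k ∈ range p, A k * B k = 0 := by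
    simp only [hA, hB, mul_assoc, ← pow_add]
    rw [sum_range_prime_neg_one_pow_mul_pow hodd, eulerZero_eq_zero_of_even, Rat.cast_zero]
    · obtain ⟨c, hc⟩ := hab
      exact ⟨p - 1 - c, by lia⟩
    · lia
  have hBAsum : ∑ k ∈ range p, B k * A k = 0 := by simpa only [mul_comm] using hABsum
  have hSab := reducesTo_S_pair hAr hBr hA0 hB0
  have hHab := reducesTo_H_pair hAr hBr hA0
  have hSba := (reducesTo_S_pair hBr hAr hB0 hA0).neg
  have hHba := (reducesTo_H_pair hBr hAr hB0).neg
  have hHS := sum_mul_sum_range_add_sum_mul_sum_range_succ A B p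
  rw [hBsum, mul_zero] at hHS
  rw [← eq_neg_of_add_eq_zero_left hHS] at hSba
  rw [sum_mul_sum_range_succ, hABsum, add_zero] at hHS
  rw [← eq_neg_of_add_eq_zero_left hHS] at hHba
  rw [sum_mul_sum_range_succ, hBAsum, add_zero] at hSab
  refine ⟨hSab.pcong hHab, hHab.pcong hSba, hSba.pcong hHba, hHba.pcong ?_⟩
  rw [sum_pow_mul_sum_neg_one_pow_mul_pow hodd (by lia)]
  have hsplit : range (p - 1 - a + 1) =
      insert 0 (Finset.Icc 1 (p - 2 - a - b) ∪ Finset.Icc (p - 1 - a - b) (p - 1 - a)) := by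
    ext k
    simp only [Finset.mem_range, Finset.mem_insert, Finset.mem_union, Finset.mem_Icc]
    lia
  have hdisj : Disjoint (Finset.Icc 1 (p - 2 - a - b))
      (Finset.Icc (p - 1 - a - b) (p - 1 - a)) := by
    rw [Finset.disjoint_left]
    simp only [Finset.mem_Icc]
    lia
  rw [hsplit, Finset.sum_insert (by simp; lia), Finset.sum_union hdisj]
  obtain ⟨c, hc⟩ := hab
  have hpc : p % 2 = 1 := Nat.odd_iff.mp hodd
  rw [eulerZero_eq_zero_of_even (n := p - 1 - b + (p - 1 - a - 0)) ⟨p - 1 - c, by lia⟩ (by lia),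
    Rat.cast_zero, mul_zero, mul_zero, zero_add]
  refine (ReducesTo.sum fun k hk => (ReducesTo.natCast _).mul ?_).add
    (ReducesTo.sum fun k hk => (ReducesTo.natCast _).mul ?_)
  · rw [Finset.mem_Icc] at hk
    have he : p - 1 - b + (p - 1 - a - k) = (p - 1 - a - b - k) + (p - 1) := by lia
    rw [he, eulerZero_add_card_sub_one hodd (by lia)]
    have h := reducesTo_bernoulli_mul_bernoulli_div hodd k (p - 1 - a - b - k) (N := a + b + k)
      (ZMod.natCast_ne_zero_of_mem_Icc (Finset.mem_Icc.mpr (by lia)))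
      (by rw [show p - 1 - a - b - k + 1 + (a + b + k) = p by lia, ZMod.natCast_self])
    rw [show p - 1 - a - b - k + 1 = p - a - b - k by lia] at h
    exact_mod_cast h
  · rw [Finset.mem_Icc] at hk
    have he : p - 1 - b + (p - 1 - a - k) = 2 * p - 2 - a - b - k := by lia
    rw [he]
    rcases hk.1.eq_or_lt with rfl | hlt
    · have heven : Even (p - 1 - a - b) := ⟨(p - 1) / 2 - c, by lia⟩
      rw [eulerZero_eq_zero_of_even heven (by lia),
        bernoulli_eq_zero_of_odd heven.add_one (by lia)]
      simpa using ReducesTo.natCast (p := p) 0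
    have hN : ((1 + a + b + k : ℕ) : ZMod p) ≠ 0 := by
      rw [show 1 + a + b + k = (1 + a + b + k - p) + p by lia, Nat.cast_add, ZMod.natCast_self,
        add_zero]
      exact ZMod.natCast_ne_zero_of_mem_Icc (Finset.mem_Icc.mpr (by lia))
    have h := reducesTo_bernoulli_mul_bernoulli_div hodd k (2 * p - 2 - a - b - k) hN
      (by rw [show 2 * p - 2 - a - b - k + 1 + (1 + a + b + k) = 2 * p by lia, Nat.cast_mul,
        ZMod.natCast_self, mul_zero])
    rw [show 2 * p - 2 - a - b - k + 1 = 2 * p - 1 - a - b - k by lia] at h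
    exact_mod_cast h
end

section
/- Let a,b,c be positive integers, w=a+b+c, and p a prime with p>w. Write H(-)=H(-;p-1). If w is even then: 2H(a,-b,c) \equiv H(-c-b,a)+H(c,-b-a) \pmod{p}; 2H(a,b,-c) \equiv -H(-c)H(b,a)+H(-c-b,a)+H(-c,b+a) \pmod{p}; and 2H(-a,-b,-c) \equiv -H(-c)H(-b,-a)-H(-c,-b)H(-a)+H(c+b,-a)+H(-c,a+b) \pmod{p}. If w is odd then: 2H(a,-b,-c) \equiv H(c+b,a)+H(-c,-b-a)-H(-c)H(-b,a) \pmod{p}; and 2H(-a,b,-c) \equiv -H(-c)H(b,-a)-H(-c,b)H(-a)+H(-c-b,-a)+H(-c,-b-a) \pmod{p}. -/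
open Finset

/-- Nested sum `∑ f₁(k₁) f₂(k₂) ⋯` over `n ≥ k₁ > k₂ > ⋯ ≥ 1`. -/
def nestedSum {K : Type*} [CommRing K] : List (ℕ → K) → ℕ → K
  | [], _ => 1
  | f :: l, n => ∑ k ∈ Finset.Icc 1 n, f k * nestedSum l (k - 1)

section NestedSum

variable {K : Type*} [CommRing K]

lemma nestedSum_nil (n : ℕ) : nestedSum ([] : List (ℕ → K)) n = 1 := rfl

lemma nestedSum_cons_zero (f : ℕ → K) (l : List (ℕ → K)) : nestedSum (f :: l) 0 = 0 := by
  simp [nestedSum]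

lemma nestedSum_cons_succ (f : ℕ → K) (l : List (ℕ → K)) (n : ℕ) :
    nestedSum (f :: l) (n + 1) = nestedSum (f :: l) n + f (n + 1) * nestedSum l n := by
  simp [nestedSum, Finset.sum_Icc_succ_top]

lemma nestedSum_stuffle (f g : ℕ → K) (n : ℕ) :
    nestedSum [f] n * nestedSum [g] n =
      nestedSum [f, g] n + nestedSum [g, f] n + nestedSum [f * g] n := by
  induction n with
  | zero => simp [nestedSum_cons_zero]
  | succ n ih =>
    simp only [nestedSum_cons_succ, nestedSum_nil, Pi.mul_apply]
    linear_combination ih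

lemma nestedSum_antipode (f g h : ℕ → K) (n : ℕ) :
    nestedSum [h, g, f] n = nestedSum [f, g, h] n + nestedSum [f, h * g] n
      + nestedSum [g * f, h] n + nestedSum [h * g * f] n
      - nestedSum [f] n * (nestedSum [g, h] n + nestedSum [h * g] n)
      + nestedSum [g, f] n * nestedSum [h] n := by
  induction n with
  | zero => simp [nestedSum_cons_zero]
  | succ n ih =>
    simp only [nestedSum_cons_succ, nestedSum_nil, Pi.mul_apply]
    linear_combination ih

lemma sum_Icc_one_reflect (F : ℕ → K) (n : ℕ) :
    ∑ k ∈ Finset.Icc 1 n, F k = ∑ k ∈ Finset.Icc 1 n, F (n + 1 - k) := by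
  refine Finset.sum_nbij' (fun k => n + 1 - k) (fun k => n + 1 - k) ?_ ?_ ?_ ?_ ?_ <;>
    simp only [Finset.mem_Icc] <;> intro k hk
  any_goals omega
  congr 1
  omega

lemma nestedSum_cons_pred (f : ℕ → K) (l : List (ℕ → K)) {n k : ℕ} (hk : k ∈ Finset.Icc 1 n) :
    nestedSum (f :: l) (k - 1) =
      ∑ j ∈ Finset.Icc 1 n, if j < k then f j * nestedSum l (j - 1) else 0 := by
  rw [← Finset.sum_filter, nestedSum]
  congr 1
  ext j
  simp only [Finset.mem_Icc, Finset.mem_filter] at hk ⊢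
  omega

lemma nestedSum_triple (f g h : ℕ → K) (n : ℕ) :
    nestedSum [h, g, f] n = ∑ k ∈ Finset.Icc 1 n, ∑ j ∈ Finset.Icc 1 n, ∑ i ∈ Finset.Icc 1 n,
      if i < j ∧ j < k then f i * g j * h k else 0 := by
  rw [nestedSum]
  refine Finset.sum_congr rfl fun k hk => ?_
  rw [nestedSum_cons_pred g [f] hk, Finset.mul_sum]
  refine Finset.sum_congr rfl fun j hj => ?_
  rw [nestedSum_cons_pred f [] hj]
  by_cases hjk : j < k
  · simp only [hjk, and_true, if_true, Finset.mul_sum, nestedSum_nil]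
    refine Finset.sum_congr rfl fun i _ => ?_
    split_ifs <;> ring
  · simp [hjk]

lemma nestedSum_triple_reflect (f g h : ℕ → K) (n : ℕ) :
    nestedSum [h, g, f] n = nestedSum [fun k => f (n + 1 - k), fun k => g (n + 1 - k),
      fun k => h (n + 1 - k)] n := by
  have reflect (F : ℕ → ℕ → ℕ → K) :
      ∑ k ∈ Finset.Icc 1 n, ∑ j ∈ Finset.Icc 1 n, ∑ i ∈ Finset.Icc 1 n, F k j i =
        ∑ i ∈ Finset.Icc 1 n, ∑ j ∈ Finset.Icc 1 n, ∑ k ∈ Finset.Icc 1 n,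
          F (n + 1 - k) (n + 1 - j) (n + 1 - i) := by
    rw [Finset.sum_comm, sum_Icc_one_reflect, Finset.sum_comm (s := Finset.Icc 1 n) (f := fun i j =>
      ∑ k ∈ Finset.Icc 1 n, F (n + 1 - k) (n + 1 - j) (n + 1 - i))]
    refine Finset.sum_congr rfl fun j _ => ?_
    rw [Finset.sum_comm, sum_Icc_one_reflect]
    exact Finset.sum_congr rfl fun i _ => sum_Icc_one_reflect _ n
  rw [nestedSum_triple, nestedSum_triple, reflect]
  refine Finset.sum_congr rfl fun k hk => Finset.sum_congr rfl fun j hj =>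
    Finset.sum_congr rfl fun i hi => ?_
  simp only [Finset.mem_Icc] at hk hj hi
  refine if_congr (by omega) (by ring) rfl

lemma nestedSum_congr_mul (l : List ((ℕ → K) × (ℕ → K) × K)) (m : ℕ)
    (hl : ∀ t ∈ l, ∀ k ∈ Finset.Icc 1 m, t.1 k = t.2.2 * t.2.1 k) {n : ℕ} (hn : n ≤ m) :
    nestedSum (l.map fun t => t.1) n =
      (l.map fun t => t.2.2).prod * nestedSum (l.map fun t => t.2.1) n := by
  induction l generalizing n with
  | nil => simp [nestedSum_nil]
  | cons t l ih =>
    simp only [List.map_cons, List.prod_cons, nestedSum, Finset.mul_sum]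
    refine Finset.sum_congr rfl fun k hk => ?_
    rw [Finset.mem_Icc] at hk
    rw [hl t (by simp) k (Finset.mem_Icc.2 ⟨hk.1, hk.2.trans hn⟩),
      ih (fun s hs => hl s (by simp [hs])) (by omega)]
    ring

end NestedSum

/-- The summand `k ↦ e ^ k / k ^ a` of a harmonic sum. -/
def harmonicTerm {K : Type*} [Field K] (e : K) (a k : ℕ) : K := e ^ k * ((k : K)⁻¹) ^ a

lemma harmonicTerm_mul {K : Type*} [Field K] (e e' : K) (a b : ℕ) :
    harmonicTerm e a * harmonicTerm e' b = harmonicTerm (e * e') (a + b) := by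
  ext k
  simp only [harmonicTerm, Pi.mul_apply]
  ring

section ModPrime

variable {p : ℕ} [Fact p.Prime]

lemma harmonicTerm_reflect {e : ZMod p} (he : e * e = 1) (a : ℕ) {k : ℕ}
    (hk : k ∈ Finset.Icc 1 (p - 1)) :
    harmonicTerm e a (p - 1 + 1 - k) = e * (-1) ^ a * harmonicTerm e a k := by
  rw [Finset.mem_Icc] at hk
  have hep := ZMod.pow_card e
  obtain ⟨m, rfl⟩ : ∃ m, p = k + m := ⟨p - k, by omega⟩
  have hm : k + m - 1 + 1 - k = m := by omega
  have hcast : (m : ZMod (k + m)) = -(k : ZMod (k + m)) := by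
    have := ZMod.natCast_self (k + m)
    push_cast at this
    linear_combination this
  have hpow : e ^ m = e * e ^ k := by
    have h1 : e ^ k * e ^ m = e := by rw [← pow_add, hep]
    have h2 : e ^ k * e ^ k = 1 := by rw [← mul_pow, he, one_pow]
    linear_combination e ^ k * h1 - e ^ m * h2
  rw [hm, harmonicTerm, harmonicTerm, hcast, hpow, inv_neg, neg_pow]
  ring

lemma nestedSum_single_reflect {e : ZMod p} (he : e * e = 1) (a : ℕ) :
    nestedSum [harmonicTerm e a] (p - 1) =
      e * (-1) ^ a * nestedSum [harmonicTerm e a] (p - 1) := by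
  conv_lhs => rw [nestedSum, sum_Icc_one_reflect]
  simp only [nestedSum, Finset.mul_sum]
  refine Finset.sum_congr rfl fun k hk => ?_
  rw [harmonicTerm_reflect he a hk]
  ring

lemma nestedSum_triple_reverse {e₁ e₂ e₃ : ZMod p} (h₁ : e₁ * e₁ = 1)
    (h₂ : e₂ * e₂ = 1) (h₃ : e₃ * e₃ = 1) (a b c : ℕ) :
    nestedSum [harmonicTerm e₁ a, harmonicTerm e₂ b, harmonicTerm e₃ c] (p - 1) =
      e₁ * e₂ * e₃ * (-1) ^ (a + b + c) *
        nestedSum [harmonicTerm e₃ c, harmonicTerm e₂ b, harmonicTerm e₁ a] (p - 1) := by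
  rw [nestedSum_triple_reflect]
  have := nestedSum_congr_mul
    [(fun k => harmonicTerm e₃ c (p - 1 + 1 - k), harmonicTerm e₃ c, e₃ * (-1) ^ c),
      (fun k => harmonicTerm e₂ b (p - 1 + 1 - k), harmonicTerm e₂ b, e₂ * (-1) ^ b),
      (fun k => harmonicTerm e₁ a (p - 1 + 1 - k), harmonicTerm e₁ a, e₁ * (-1) ^ a)]
    (p - 1) (by
      simp only [List.forall_mem_cons]
      exact ⟨fun k => harmonicTerm_reflect h₃ c, fun k => harmonicTerm_reflect h₂ b,
        fun k => harmonicTerm_reflect h₁ a, by simp⟩) le_rfl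
  simp only [List.map_cons, List.map_nil, List.prod_cons, List.prod_nil] at this
  rw [this]
  ring

lemma eq_zero_of_eq_neg (hp2 : Odd p) {x : ZMod p} (hx : x = -x) : x = 0 := by
  have : Fact (2 < p) := ⟨by
    have := (Fact.out : p.Prime).two_le
    obtain ⟨r, hr⟩ := hp2
    omega⟩
  by_contra h
  exact ZMod.ne_neg_self hp2 h hx

lemma nestedSum_single_eq_zero_of_sign (hp2 : Odd p) {e : ZMod p} (he : e * e = 1) {a : ℕ}
    (h : e * (-1) ^ a = -1) : nestedSum [harmonicTerm e a] (p - 1) = 0 := by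
  refine eq_zero_of_eq_neg hp2 ?_
  conv_lhs => rw [nestedSum_single_reflect he, h, neg_one_mul]

lemma nestedSum_alternating_eq_zero (hp2 : Odd p) {a : ℕ} (ha : Even a) :
    nestedSum [harmonicTerm (-1 : ZMod p) a] (p - 1) = 0 :=
  nestedSum_single_eq_zero_of_sign hp2 (by ring) (by rw [ha.neg_one_pow]; ring)

lemma nestedSum_alternating_mul_eq_zero (hp2 : Odd p) {a b : ℕ} (hab : Odd (a + b)) :
    nestedSum [harmonicTerm (-1 : ZMod p) a] (p - 1) *
      nestedSum [harmonicTerm (-1 : ZMod p) b] (p - 1) = 0 := by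
  rcases Nat.even_or_odd a with ha | ha
  · rw [nestedSum_alternating_eq_zero hp2 ha, zero_mul]
  · rw [nestedSum_alternating_eq_zero hp2 (a := b) (by grind), mul_zero]

lemma nestedSum_one_eq_zero {a : ℕ} (ha : 0 < a) (hap : a < p - 1) :
    nestedSum [harmonicTerm (1 : ZMod p) a] (p - 1) = 0 := by
  have hsum : ∑ x : ZMod p, (x⁻¹) ^ a = 0 := by
    refine (Equiv.sum_comp (Equiv.inv (ZMod p)) (fun x => x ^ a)).trans ?_
    exact FiniteField.sum_pow_lt_card_sub_one (ZMod p) a (by rwa [ZMod.card])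
  rw [← hsum, nestedSum]
  simp only [nestedSum_nil, mul_one, harmonicTerm, one_pow, one_mul]
  rw [← Finset.sum_erase (s := Finset.univ) (a := (0 : ZMod p)) (by simp [ha.ne'])]
  have hpos := (Fact.out : p.Prime).pos
  refine Finset.sum_nbij' (fun k => (k : ZMod p)) ZMod.val ?_ ?_ ?_ ?_ ?_
  · intro k hk
    rw [Finset.mem_Icc] at hk
    simp only [Finset.mem_erase, Finset.mem_univ, and_true, ne_eq, ZMod.natCast_eq_zero_iff]
    exact Nat.not_dvd_of_pos_of_lt (by omega) (by omega)
  · intro x hx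
    have := ZMod.val_lt x
    have := (ZMod.val_ne_zero x).2 (Finset.ne_of_mem_erase hx)
    rw [Finset.mem_Icc]
    omega
  · intro k hk
    rw [Finset.mem_Icc] at hk
    exact ZMod.val_cast_of_lt (by omega)
  · intro x _
    exact ZMod.natCast_zmod_val x
  · intro k _
    rfl

end ModPrime

/-- The rational `x` is `p`-integral with residue `z` modulo `p`. -/
def HasResidue (p : ℕ) (x : ℚ) (z : ZMod p) : Prop :=
  ∃ n d : ℤ, (d : ZMod p) ≠ 0 ∧ x * d = n ∧ z * d = n

namespace HasResidue

variable {p : ℕ} [Fact p.Prime] {x y : ℚ} {z w : ZMod p}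

lemma intCast (m : ℤ) : HasResidue p m (m : ZMod p) := ⟨m, 1, by simp, by simp, by simp⟩

lemma add (hx : HasResidue p x z) (hy : HasResidue p y w) : HasResidue p (x + y) (z + w) := by
  obtain ⟨n, d, hd, h₁, h₂⟩ := hx
  obtain ⟨n', d', hd', h₁', h₂'⟩ := hy
  refine ⟨n * d' + n' * d, d * d', by push_cast; exact mul_ne_zero hd hd', ?_, ?_⟩ <;> push_cast
  · linear_combination d' * h₁ + d * h₁'
  · linear_combination d' * h₂ + d * h₂'

lemma mul (hx : HasResidue p x z) (hy : HasResidue p y w) : HasResidue p (x * y) (z * w) := by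
  obtain ⟨n, d, hd, h₁, h₂⟩ := hx
  obtain ⟨n', d', hd', h₁', h₂'⟩ := hy
  refine ⟨n * n', d * d', by push_cast; exact mul_ne_zero hd hd', ?_, ?_⟩ <;> push_cast
  · rw [← h₁, ← h₁']; ring
  · rw [← h₂, ← h₂']; ring

lemma neg (hx : HasResidue p x z) : HasResidue p (-x) (-z) := by
  simpa using (intCast (p := p) (-1)).mul hx

lemma sub (hx : HasResidue p x z) (hy : HasResidue p y w) : HasResidue p (x - y) (z - w) := by
  simpa only [sub_eq_add_neg] using hx.add hy.neg

lemma two_mul (hx : HasResidue p x z) : HasResidue p (2 * x) (2 * z) := by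
  simpa using (intCast (p := p) 2).mul hx

lemma pow (hx : HasResidue p x z) (m : ℕ) : HasResidue p (x ^ m) (z ^ m) := by
  induction m with
  | zero => simpa using intCast (p := p) 1
  | succ m ih => simpa only [pow_succ] using ih.mul hx

lemma natCast_inv {k : ℕ} (hk : (k : ZMod p) ≠ 0) : HasResidue p ((k : ℚ)⁻¹) ((k : ZMod p)⁻¹) := by
  have hk' : (k : ℚ) ≠ 0 := by
    rintro h
    exact hk (by rw [Nat.cast_eq_zero.1 h, Nat.cast_zero])
  exact ⟨1, k, by simpa using hk, by simp [hk'], by simp [hk]⟩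

lemma sum {ι : Type*} (s : Finset ι) {f : ι → ℚ} {g : ι → ZMod p}
    (h : ∀ i ∈ s, HasResidue p (f i) (g i)) : HasResidue p (∑ i ∈ s, f i) (∑ i ∈ s, g i) := by
  classical
  induction s using Finset.induction_on with
  | empty => simpa using intCast (p := p) 0
  | insert i s hi ih =>
    rw [Finset.sum_insert hi, Finset.sum_insert hi]
    exact (h i (by simp)).add (ih fun j hj => h j (by simp [hj]))

lemma pcong (hx : HasResidue p x z) (hy : HasResidue p y w) (hzw : z = w) : _root_.pcong p x y := by
  obtain ⟨n, d, hd, h₁, h₂⟩ := hx.sub hy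
  rw [hzw, sub_self, zero_mul] at h₂
  have hp : Prime (p : ℤ) := Nat.prime_iff_prime_int.1 Fact.out
  have hn : (p : ℤ) ∣ n := (ZMod.intCast_zmod_eq_zero_iff_dvd n p).1 h₂.symm
  have hd' : ¬(p : ℤ) ∣ d := fun h => hd ((ZMod.intCast_zmod_eq_zero_iff_dvd d p).2 h)
  have key : (x - y).num * d = n * (x - y).den := by
    have hden := Rat.mul_den_eq_num (x - y)
    have : ((x - y).num : ℚ) * d = n * (x - y).den := by
      rw [← hden, ← h₁]
      ring
    exact_mod_cast this
  exact (hp.dvd_or_dvd (key ▸ hn.mul_right _)).resolve_right hd'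

end HasResidue

/-- The residue modulo `p` of the summand attached to the index `s`. -/
def residueTerm (p : ℕ) [Fact p.Prime] (s : ℤ) : ℕ → ZMod p :=
  harmonicTerm (if s < 0 then -1 else 1) s.natAbs

section Transfer

variable {p : ℕ} [Fact p.Prime]

lemma residueTerm_natCast (a : ℕ) : residueTerm p (a : ℤ) = harmonicTerm 1 a := by
  simp [residueTerm, (Int.natCast_nonneg a).not_gt]

lemma residueTerm_neg_natCast {a : ℕ} (ha : 0 < a) :
    residueTerm p (-(a : ℤ)) = harmonicTerm (-1) a := by
  simp [residueTerm, ha]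

lemma hasResidue_summand (s : ℤ) {k : ℕ} (hk : (k : ZMod p) ≠ 0) :
    HasResidue p (sgn s ^ k / (k : ℚ) ^ s.natAbs) (residueTerm p s k) := by
  rw [div_eq_mul_inv, ← inv_pow]
  refine HasResidue.mul (HasResidue.pow ?_ k) ((HasResidue.natCast_inv hk).pow _)
  rw [sgn]
  split_ifs
  · simpa using HasResidue.intCast (p := p) (-1)
  · simpa using HasResidue.intCast (p := p) 1

lemma hasResidue_Hrev (l : List ℤ) {n : ℕ} (hn : n < p) :
    HasResidue p (Hrev l n) (nestedSum (l.map (residueTerm p)) n) := by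
  induction l generalizing n with
  | nil => simpa [Hrev, nestedSum] using HasResidue.intCast (p := p) 1
  | cons s l ih =>
    rw [Hrev, List.map_cons, nestedSum]
    refine HasResidue.sum _ fun k hk => ?_
    rw [Finset.mem_Icc] at hk
    refine (hasResidue_summand s ?_).mul (ih (by omega))
    rw [ne_eq, ZMod.natCast_eq_zero_iff]
    exact Nat.not_dvd_of_pos_of_lt (by omega) (by omega)

lemma hasResidue_H (l : List ℤ) :
    HasResidue p (H l (p - 1)) (nestedSum (l.reverse.map (residueTerm p)) (p - 1)) :=
  hasResidue_Hrev _ (Nat.sub_lt (Fact.out : p.Prime).pos one_pos)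

lemma two_mul_nestedSum_triple (hp2 : Odd p) {e₁ e₂ e₃ : ZMod p} (h₁ : e₁ * e₁ = 1)
    (h₂ : e₂ * e₂ = 1) (h₃ : e₃ * e₃ = 1) {a b c : ℕ}
    (h : e₁ * e₂ * e₃ * (-1) ^ (a + b + c) = -1) :
    2 * nestedSum [harmonicTerm e₃ c, harmonicTerm e₂ b, harmonicTerm e₁ a] (p - 1) =
      nestedSum [harmonicTerm e₁ a, harmonicTerm (e₃ * e₂) (c + b)] (p - 1)
      + nestedSum [harmonicTerm (e₂ * e₁) (b + a), harmonicTerm e₃ c] (p - 1)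
      - nestedSum [harmonicTerm e₁ a] (p - 1) *
        (nestedSum [harmonicTerm e₂ b, harmonicTerm e₃ c] (p - 1) +
          nestedSum [harmonicTerm (e₃ * e₂) (c + b)] (p - 1))
      + (nestedSum [harmonicTerm e₁ a] (p - 1) * nestedSum [harmonicTerm e₂ b] (p - 1)
          - nestedSum [harmonicTerm e₁ a, harmonicTerm e₂ b] (p - 1)
          - nestedSum [harmonicTerm (e₂ * e₁) (b + a)] (p - 1))
        * nestedSum [harmonicTerm e₃ c] (p - 1) := by
  have hanti := nestedSum_antipode (harmonicTerm e₁ a) (harmonicTerm e₂ b) (harmonicTerm e₃ c)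
    (p - 1)
  have hst := nestedSum_stuffle (harmonicTerm e₂ b) (harmonicTerm e₁ a) (p - 1)
  have hrev := nestedSum_triple_reverse h₁ h₂ h₃ a b c
  rw [h] at hrev
  simp only [harmonicTerm_mul] at hanti hst
  have htot : nestedSum [harmonicTerm (e₃ * e₂ * e₁) (c + b + a)] (p - 1) = 0 := by
    refine nestedSum_single_eq_zero_of_sign hp2 ?_ ?_
    · linear_combination e₂ * e₂ * e₃ * e₃ * h₁ + e₃ * e₃ * h₂ + h₃
    · rw [show c + b + a = a + b + c by ring]
      linear_combination h
  linear_combination hanti + hrev + htot -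
    nestedSum [harmonicTerm e₃ c] (p - 1) * hst

end Transfer

/-- Depth three stuffle/reversal congruences. -/
theorem depth_three_stuffle (a b c : ℕ) (ha : 0 < a) (hb : 0 < b) (hc : 0 < c)
    (p : ℕ) (hp : p.Prime) (hpw : a + b + c < p) :
    (Even (a + b + c) →
      pcong p (2 * H [(a : ℤ), -(b : ℤ), (c : ℤ)] (p - 1))
        (H [-((c : ℤ) + b), (a : ℤ)] (p - 1) + H [(c : ℤ), -((b : ℤ) + a)] (p - 1)) ∧
      pcong p (2 * H [(a : ℤ), (b : ℤ), -(c : ℤ)] (p - 1))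
        (-H [-(c : ℤ)] (p - 1) * H [(b : ℤ), (a : ℤ)] (p - 1) +
          H [-((c : ℤ) + b), (a : ℤ)] (p - 1) + H [-(c : ℤ), (b : ℤ) + a] (p - 1)) ∧
      pcong p (2 * H [-(a : ℤ), -(b : ℤ), -(c : ℤ)] (p - 1))
        (-H [-(c : ℤ)] (p - 1) * H [-(b : ℤ), -(a : ℤ)] (p - 1) -
          H [-(c : ℤ), -(b : ℤ)] (p - 1) * H [-(a : ℤ)] (p - 1) +
          H [(c : ℤ) + b, -(a : ℤ)] (p - 1) + H [-(c : ℤ), (a : ℤ) + b] (p - 1))) ∧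
    (Odd (a + b + c) →
      pcong p (2 * H [(a : ℤ), -(b : ℤ), -(c : ℤ)] (p - 1))
        (H [(c : ℤ) + b, (a : ℤ)] (p - 1) + H [-(c : ℤ), -((b : ℤ) + a)] (p - 1) -
          H [-(c : ℤ)] (p - 1) * H [-(b : ℤ), (a : ℤ)] (p - 1)) ∧
      pcong p (2 * H [-(a : ℤ), (b : ℤ), -(c : ℤ)] (p - 1))
        (-H [-(c : ℤ)] (p - 1) * H [(b : ℤ), -(a : ℤ)] (p - 1) -
          H [-(c : ℤ), (b : ℤ)] (p - 1) * H [-(a : ℤ)] (p - 1) +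
          H [-((c : ℤ) + b), -(a : ℤ)] (p - 1) + H [-(c : ℤ), -((b : ℤ) + a)] (p - 1))) := by
  have : Fact p.Prime := ⟨hp⟩
  have hp2 : Odd p := hp.odd_of_ne_two (by omega)
  have r := fun l => hasResidue_H (p := p) l
  have hcb0 : 0 < c + b := by omega
  have hba0 : 0 < b + a := by omega
  have za := nestedSum_one_eq_zero (p := p) ha (by omega)
  have zb := nestedSum_one_eq_zero (p := p) hb (by omega)
  have zc := nestedSum_one_eq_zero (p := p) hc (by omega)
  have zcb := nestedSum_one_eq_zero (p := p) hcb0 (by omega)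
  have zba := nestedSum_one_eq_zero (p := p) hba0 (by omega)
  have one : (1 : ZMod p) * 1 = 1 := one_mul 1
  have neg : (-1 : ZMod p) * -1 = 1 := by ring
  simp only [← Nat.cast_add]
  refine ⟨fun hw => ⟨?_, ?_, ?_⟩, fun hw => ⟨?_, ?_⟩⟩
  · refine (r _).two_mul.pcong ((r _).add (r _)) ?_
    have key := two_mul_nestedSum_triple hp2 one neg one (a := a) (b := b) (c := c)
      (by rw [hw.neg_one_pow]; ring)
    simp only [List.reverse_cons, List.reverse_nil, List.nil_append, List.cons_append,
      List.map_cons, List.map_nil, residueTerm_natCast, residueTerm_neg_natCast, hb, hcb0, hba0]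
    simp only [one_mul, mul_one, za, zc] at key
    linear_combination key
  · refine (r _).two_mul.pcong ((((r _).neg.mul (r _)).add (r _)).add (r _)) ?_
    have key := two_mul_nestedSum_triple hp2 one one neg (a := a) (b := b) (c := c)
      (by rw [hw.neg_one_pow]; ring)
    simp only [List.reverse_cons, List.reverse_nil, List.nil_append, List.cons_append,
      List.map_cons, List.map_nil, residueTerm_natCast, residueTerm_neg_natCast, hc, hcb0]
    simp only [mul_one, za, zb, zba] at key
    linear_combination key
  · refine (r _).two_mul.pcong
      (((((r _).neg.mul (r _)).sub ((r _).mul (r _))).add (r _)).add (r _)) ?_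
    have key := two_mul_nestedSum_triple hp2 neg neg neg (a := a) (b := b) (c := c)
      (by rw [hw.neg_one_pow]; ring)
    have hprod : nestedSum [harmonicTerm (-1 : ZMod p) a] (p - 1) *
        nestedSum [harmonicTerm (-1 : ZMod p) b] (p - 1) *
        nestedSum [harmonicTerm (-1 : ZMod p) c] (p - 1) = 0 := by
      rcases Nat.even_or_odd (a + b) with hab | hab
      · rw [nestedSum_alternating_eq_zero hp2 (a := c) (by grind), mul_zero]
      · rw [nestedSum_alternating_mul_eq_zero hp2 hab, zero_mul]
    simp only [List.reverse_cons, List.reverse_nil, List.nil_append, List.cons_append,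
      List.map_cons, List.map_nil, residueTerm_natCast, residueTerm_neg_natCast, add_comm a b,
      ha, hb, hc]
    simp only [neg, zcb, zba] at key
    linear_combination key + hprod
  · refine (r _).two_mul.pcong (((r _).add (r _)).sub ((r _).mul (r _))) ?_
    have key := two_mul_nestedSum_triple hp2 one neg neg (a := a) (b := b) (c := c)
      (by rw [hw.neg_one_pow]; ring)
    have hprod := nestedSum_alternating_mul_eq_zero hp2 (a := b + a) (b := c) (by grind)
    simp only [List.reverse_cons, List.reverse_nil, List.nil_append, List.cons_append,
      List.map_cons, List.map_nil, residueTerm_natCast, residueTerm_neg_natCast, hb, hc, hba0]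
    simp only [mul_one, neg, za, zcb] at key
    linear_combination key - hprod
  · refine (r _).two_mul.pcong
      (((((r _).neg.mul (r _)).sub ((r _).mul (r _))).add (r _)).add (r _)) ?_
    have key := two_mul_nestedSum_triple hp2 neg one neg (a := a) (b := b) (c := c)
      (by rw [hw.neg_one_pow]; ring)
    have hprod := nestedSum_alternating_mul_eq_zero hp2 (a := b + a) (b := c) (by grind)
    have hprod' := nestedSum_alternating_mul_eq_zero hp2 (a := a) (b := c + b) (by grind)
    simp only [List.reverse_cons, List.reverse_nil, List.nil_append, List.cons_append,
      List.map_cons, List.map_nil, residueTerm_natCast, residueTerm_neg_natCast, ha, hc,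
      hcb0, hba0]
    simp only [one_mul, mul_one, zb] at key
    linear_combination key - hprod - hprod'
end
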